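/- arXiv:1306.2390 — 2 statements merged into one kernel-verified Lean document; each statement's English description precedes it below -/
import Mathlib

section
/- Let Ω ⊆ ℂⁿ be a bounded domain and p ∈ ∂Ω a spherically-extreme boundary point (∂Ω is C² near p in the sense of a local C² defining function with nonvanishing gradient, and there is a ball B(c,R) ⊇ Ω with ‖p − c‖ = R). Then for every ε with 0 < ε < 1/2 there exists r > 0 such that for every q ∈ Ω ∩ B(p, r) there is an injective holomorphic map G : Ω → ℂⁿ with G(q) = 0 and B(0, 1−ε) ⊆ G(Ω) ⊆ B(0, 1+ε). -/
open Metric Set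

/-- A slowly varying cut-off: holomorphic and zero free on the right half plane, nearly real and
positive, equal to `1` at the origin and small away from it. -/
theorem exists_holomorphic_cutoff {σ m : ℝ} (hσ : 0 < σ) (hm : 0 < m) :
    ∃ g : ℂ → ℂ, DifferentiableOn ℂ g {u | 0 < u.re} ∧ ContinuousAt g 0 ∧ g 0 = 1 ∧
      (∀ u, g u ≠ 0) ∧ ∀ u : ℂ, 0 < u.re → ‖g u‖ ≤ 1 ∧
        ‖g u ^ 2 - ((‖g u‖ ^ 2 : ℝ) : ℂ)‖ ≤ σ ∧ (m ≤ ‖u‖ → ‖g u‖ ^ 2 ≤ σ) := by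
  obtain ⟨s, hs, hsσ⟩ : ∃ s : ℝ, 0 < s ∧ 2 * s * Real.pi ≤ σ :=
    ⟨σ / (2 * Real.pi), by positivity, by field_simp; rfl⟩
  obtain ⟨K, hK⟩ : ∃ K : ℝ, 2 * s * K = - Real.log σ := ⟨-Real.log σ / (2 * s), by field_simp⟩
  set N : ℝ := Real.exp K / m with hN
  have hNpos : 0 < N := by positivity
  have hslit : ∀ u : ℂ, 0 ≤ u.re → 1 + N * u ∈ Complex.slitPlane := fun u hu => by
    left; simp; positivity
  have hdiff : ∀ u : ℂ, 0 ≤ u.re →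
      DifferentiableAt ℂ (fun u : ℂ => Complex.exp (-s * Complex.log (1 + N * u))) u := by
    intro u hu
    have := hslit u hu
    fun_prop (disch := assumption)
  refine ⟨fun u => Complex.exp (-s * Complex.log (1 + N * u)),
    fun u hu => (hdiff u (le_of_lt hu)).differentiableWithinAt,
    (hdiff 0 le_rfl).continuousAt, by simp, fun u => Complex.exp_ne_zero _, fun u hu => ?_⟩
  set l := Complex.log (1 + N * u) with hl
  have hre : l.re = Real.log ‖1 + N * u‖ := Complex.log_re _
  have hge : (1 + N * u).re ≤ ‖1 + N * u‖ := Complex.re_le_norm _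
  have hone : 1 ≤ ‖1 + N * u‖ := by
    refine le_trans ?_ hge
    simp; positivity
  have hnorm : ‖Complex.exp (-s * l)‖ = Real.exp (-s * l.re) := by
    rw [Complex.norm_exp]; simp
  have hlre : 0 ≤ l.re := hre ▸ Real.log_nonneg hone
  have hsq : ‖Complex.exp (-s * l)‖ ^ 2 = Real.exp (-(2 * s * l.re)) := by
    rw [hnorm, ← Real.exp_nat_mul]; congr 1; push_cast; ring
  refine ⟨?_, ?_, fun hmu => ?_⟩
  · rw [hnorm, Real.exp_le_one_iff]; nlinarith
  · have h1 : Complex.exp (-s * l) ^ 2 - ((‖Complex.exp (-s * l)‖ ^ 2 : ℝ) : ℂ)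
        = ((Real.exp (-(2 * s * l.re)) : ℝ) : ℂ) *
          (Complex.exp (Complex.I * ((-(2 * s * l.im) : ℝ) : ℂ)) - 1) := by
      rw [hsq, mul_sub, mul_one, Complex.ofReal_exp, ← Complex.exp_add, ← Complex.exp_nat_mul]
      congr 2
      apply Complex.ext <;> simp <;> ring
    rw [h1, norm_mul, Complex.norm_real, Real.norm_of_nonneg (Real.exp_nonneg _)]
    have h2 : Real.exp (-(2 * s * l.re)) ≤ 1 := by
      rw [Real.exp_le_one_iff, neg_nonpos]; positivity
    have h3 := Real.norm_exp_I_mul_ofReal_sub_one_le (x := -(2 * s * l.im))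
    have h4 : |l.im| ≤ Real.pi := by rw [hl, Complex.log_im]; exact Complex.abs_arg_le_pi _
    have h5 : ‖-(2 * s * l.im)‖ ≤ σ := by
      rw [norm_neg, norm_mul, Real.norm_of_nonneg (by positivity : 0 ≤ 2 * s), Real.norm_eq_abs]
      exact le_trans (by gcongr) hsσ
    calc _ ≤ 1 * ‖-(2 * s * l.im)‖ := by gcongr
      _ ≤ σ := by linarith
  · rw [hsq]
    have h1 : N * ‖u‖ ≤ ‖1 + N * u‖ := by
      have h0 : N * ‖u‖ = ‖(N : ℂ) * u‖ := by
        rw [norm_mul, Complex.norm_real, Real.norm_of_nonneg hNpos.le]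
      rw [h0, ← abs_of_nonneg (norm_nonneg ((N : ℂ) * u)),
        ← abs_of_nonneg (norm_nonneg (1 + (N : ℂ) * u)),
        ← sq_le_sq, Complex.sq_norm, Complex.sq_norm, Complex.normSq_apply, Complex.normSq_apply]
      simp
      nlinarith [mul_pos hNpos hu]
    have h2 : Real.exp K ≤ ‖1 + N * u‖ := by
      refine le_trans ?_ h1
      calc Real.exp K = N * m := by rw [hN]; field_simp
        _ ≤ _ := by gcongr
    have h3 : K ≤ l.re := by
      rw [hre, Real.le_log_iff_exp_le (by linarith)]; exact h2
    rw [← Real.le_log_iff_exp_le hσ]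
    nlinarith

section Model

variable {V E : Type*} [NormedAddCommGroup V] [NormedSpace ℂ V]
  [NormedAddCommGroup E] [NormedSpace ℂ E]

/-- The Cayley transform of the Siegel domain `{H ζ < Re f}`, preceded by the anisotropic dilation
with factor `δ⁻¹`. -/
noncomputable def siegelToBall (L : (ℂ × V) ≃L[ℂ] E) (δ : ℝ) (w : ℂ × V) : E :=
  L ((δ - w.1) / (δ + w.1), (2 * (√δ : ℂ) / (δ + w.1)) • w.2)

theorem norm_siegelToBall_sq {H : V → ℝ} (hHh : ∀ (c : ℂ) v, H (c • v) = ‖c‖ ^ 2 * H v)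
    {L : (ℂ × V) ≃L[ℂ] E} (hL : ∀ w, ‖L w‖ ^ 2 = ‖w.1‖ ^ 2 + H w.2) {δ : ℝ} (hδ : 0 < δ)
    {w : ℂ × V} (hw : (δ : ℂ) + w.1 ≠ 0) :
    ‖siegelToBall L δ w‖ ^ 2 * ‖(δ : ℂ) + w.1‖ ^ 2
      = ‖(δ : ℂ) + w.1‖ ^ 2 + 4 * δ * (H w.2 - w.1.re) := by
  have h0 : ‖(δ : ℂ) + w.1‖ ≠ 0 := norm_ne_zero_iff.2 hw
  have h1 : ‖(δ : ℂ) - w.1‖ ^ 2 = ‖(δ : ℂ) + w.1‖ ^ 2 - 4 * δ * w.1.re := by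
    rw [Complex.sq_norm, Complex.sq_norm, Complex.normSq_apply, Complex.normSq_apply]
    simp; ring
  have h2 : ‖2 * (√δ : ℂ)‖ ^ 2 = 4 * δ := by
    rw [norm_mul, mul_pow, Complex.norm_real, Real.norm_of_nonneg (Real.sqrt_nonneg _),
      Real.sq_sqrt hδ.le]
    norm_num
  rw [siegelToBall, hL, hHh, norm_div, norm_div, div_pow, div_pow, h1, h2]
  field_simp
  ring

theorem siegelToBall_injective {L : (ℂ × V) ≃L[ℂ] E} {δ : ℝ} (hδ : 0 < δ)
    {w w' : ℂ × V} (hw : (δ : ℂ) + w.1 ≠ 0) (hw' : (δ : ℂ) + w'.1 ≠ 0)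
    (h : siegelToBall L δ w = siegelToBall L δ w') : w = w' := by
  have h1 := L.injective h
  rw [Prod.mk.injEq, div_eq_div_iff hw hw'] at h1
  have hδ' : (δ : ℂ) ≠ 0 := by exact_mod_cast hδ.ne'
  have h2 : w.1 = w'.1 := by
    have : (2 * (δ : ℂ)) * (w.1 - w'.1) = 0 := by linear_combination -h1.1
    simpa [hδ', sub_eq_zero] using this
  have h3 := h1.2
  rw [h2] at h3
  have h4 : 2 * (√δ : ℂ) / (δ + w'.1) ≠ 0 := by
    have : (√δ : ℂ) ≠ 0 := by exact_mod_cast (Real.sqrt_pos.2 hδ).ne'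
    exact div_ne_zero (mul_ne_zero two_ne_zero this) hw'
  exact Prod.ext h2 (smul_right_injective V h4 h3)

theorem siegelToBall_inverse {L : (ℂ × V) ≃L[ℂ] E} {δ : ℝ} (hδ : 0 < δ) {a : ℂ} {b : V}
    (ha : 1 + a ≠ 0) :
    siegelToBall L δ (δ * (1 - a) / (1 + a), ((√δ : ℂ) / (1 + a)) • b) = L (a, b) := by
  have hδ' : (δ : ℂ) ≠ 0 := by exact_mod_cast hδ.ne'
  have hs : (√δ : ℂ) * √δ = δ := by exact_mod_cast Real.mul_self_sqrt hδ.le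
  have h1 : (δ : ℂ) + δ * (1 - a) / (1 + a) = 2 * δ / (1 + a) := by field_simp; ring
  rw [siegelToBall]
  congr 1
  ext
  · simp only [h1]; field_simp; ring
  · simp only [h1, smul_smul]
    rw [show 2 * (√δ : ℂ) / (2 * δ / (1 + a)) * (√δ / (1 + a)) = 1 from ?_, one_smul]
    field_simp
    linear_combination hs

/-- If `(u, z)` lies in a region that is close, to second order, to `{H z + Re P z < Re u}`, then
removing the pluriharmonic term `P` with a cut-off of value `γ` puts it close to the Siegel domain
of `H`. -/
theorem shear_estimate {P : V → ℂ} (hPh : ∀ (c : ℂ) v, P (c • v) = c ^ 2 * P v) {C κ : ℝ}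
    (hκ : 0 < κ) (hC : 0 ≤ C) (hPC : ∀ v, ‖P v‖ ≤ C * ‖v‖ ^ 2)
    {H : V → ℝ} (hHh : ∀ (c : ℂ) v, H (c • v) = ‖c‖ ^ 2 * H v)
    (hHκ : ∀ v, κ * ‖v‖ ^ 2 ≤ H v) (hHC : ∀ v, H v ≤ C * ‖v‖ ^ 2) {ε η : ℝ} (hε : 0 < ε)
    (hε2 : ε < 1 / 2) (hη : 0 ≤ η) (hηε : 64 * ((1 + C / κ) * (1 + (1 + 3 * C) / κ) * η) ≤ ε)
    {u γ : ℂ} {z : V} (hu : 0 < u.re) (hz : κ * ‖z‖ ^ 2 ≤ u.re) (hγ : ‖γ‖ ≤ 1)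
    (hγ2 : ‖γ ^ 2 - ((‖γ‖ ^ 2 : ℝ) : ℂ)‖ ≤ η)
    (hcase : H z + (P z).re ≤ u.re + η * (‖z‖ ^ 2 + ‖u‖) ∨ ‖γ‖ ^ 2 ≤ η) :
    H (γ • z) - (u - P (γ • z)).re ≤ ε / 32 * ‖u - P (γ • z)‖ ∧ 0 < ‖u - P (γ • z)‖ := by
  set f := u - P (γ • z) with hf
  set a := ‖γ‖ ^ 2 with ha
  have ha0 : 0 ≤ a := by positivity
  have ha1 : a ≤ 1 := by rw [ha]; exact pow_le_one₀ (norm_nonneg _) hγ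
  have hu' : u.re ≤ ‖u‖ := Complex.re_le_norm u
  set x := ‖z‖ ^ 2 with hx
  have hx0 : 0 ≤ x := by positivity
  have hxu : x ≤ ‖u‖ / κ := by rw [le_div_iff₀ hκ]; linarith
  have hPre : (P z).re ≤ C * x := (Complex.re_le_norm _).trans (hPC z)
  have hP : (P (γ • z)).re ≤ a * (P z).re + η * (C * x) := by
    have h1 : P (γ • z) = (γ ^ 2 - ((a : ℝ) : ℂ)) * P z + ((a : ℝ) : ℂ) * P z := by
      rw [hPh]; ring
    rw [h1, Complex.add_re, Complex.re_ofReal_mul]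
    have h2 : ((γ ^ 2 - ((a : ℝ) : ℂ)) * P z).re ≤ η * (C * x) := by
      refine (Complex.re_le_norm _).trans ?_
      rw [norm_mul]
      exact mul_le_mul hγ2 (hPC z) (norm_nonneg _) hη
    linarith
  have hHz := hHC z
  have hCx : 0 ≤ C * x := by positivity
  have key : H (γ • z) - f.re ≤ η * (1 + (1 + 3 * C) / κ) * ‖u‖ := by
    have h1 : H (γ • z) - f.re ≤ η * (x + ‖u‖ + 3 * (C * x)) := by
      rw [hf, Complex.sub_re, hHh]
      rcases hcase with h | h
      · have h3 : a * (H z + (P z).re) ≤ a * (u.re + η * (x + ‖u‖)) := by gcongr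
        have h4 : a * (u.re + η * (x + ‖u‖)) ≤ 1 * (u.re + η * (x + ‖u‖)) := by gcongr
        nlinarith [mul_nonneg hη hCx]
      · have h3 : a * (H z + (P z).re) ≤ a * (2 * (C * x)) := by gcongr; linarith
        have h4 : a * (2 * (C * x)) ≤ η * (2 * (C * x)) := by gcongr
        nlinarith [mul_nonneg hη hx0, mul_nonneg hη (norm_nonneg u)]
    refine h1.trans ?_
    have : (1 + 3 * C) * x ≤ (1 + 3 * C) * (‖u‖ / κ) := by gcongr
    calc _ = η * (‖u‖ + (1 + 3 * C) * x) := by ring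
      _ ≤ η * (‖u‖ + (1 + 3 * C) * (‖u‖ / κ)) := by gcongr
      _ = _ := by ring
  set B := C / κ with hB
  have hB0 : 0 ≤ B := by positivity
  set k := η * (1 + (1 + 3 * C) / κ) with hk
  have hk0 : 0 ≤ k := by positivity
  have hkε : 64 * ((1 + B) * k) ≤ ε := by rw [hk]; linarith
  have hub : ‖u‖ ≤ ‖f‖ + B * H (γ • z) := by
    have h1 : ‖u‖ ≤ ‖f‖ + ‖P (γ • z)‖ := by
      calc ‖u‖ = ‖f + P (γ • z)‖ := by rw [hf]; congr 1; ring
        _ ≤ _ := norm_add_le _ _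
    have h2 : C * ‖γ • z‖ ^ 2 ≤ B * H (γ • z) := by
      calc C * ‖γ • z‖ ^ 2 = B * (κ * ‖γ • z‖ ^ 2) := by rw [hB]; field_simp
        _ ≤ _ := by gcongr; exact hHκ _
    linarith [hPC (γ • z)]
  have hfre : f.re ≤ ‖f‖ := Complex.re_le_norm f
  have hu2 : ‖u‖ ≤ 2 * (1 + B) * ‖f‖ := by
    have h1 : B * H (γ • z) ≤ B * (‖f‖ + k * ‖u‖) := by gcongr; linarith
    have h2 : B * k ≤ 1 / 2 := by nlinarith
    have h3 : B * k * ‖u‖ ≤ 1 / 2 * ‖u‖ := by gcongr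
    nlinarith
  constructor
  · refine key.trans ?_
    calc k * ‖u‖ ≤ k * (2 * (1 + B) * ‖f‖) := by gcongr
      _ = (64 * ((1 + B) * k)) / 32 * ‖f‖ := by ring
      _ ≤ _ := by gcongr
  · by_contra h
    have : ‖f‖ = 0 := le_antisymm (not_lt.1 h) (norm_nonneg _)
    rw [this] at hu2
    linarith

theorem norm_siegelToBall_le {H : V → ℝ} (hHh : ∀ (c : ℂ) v, H (c • v) = ‖c‖ ^ 2 * H v)
    (hH0 : ∀ v, 0 ≤ H v)
    {L : (ℂ × V) ≃L[ℂ] E} (hL : ∀ w, ‖L w‖ ^ 2 = ‖w.1‖ ^ 2 + H w.2) {δ ε : ℝ} (hδ : 0 < δ)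
    (hε : 0 < ε) (hε2 : ε < 1 / 2) {w : ℂ × V} (hw : H w.2 - w.1.re ≤ ε / 32 * ‖w.1‖) :
    (δ : ℂ) + w.1 ≠ 0 ∧ ‖siegelToBall L δ w‖ < 1 + ε / 2 := by
  have h1 : ‖(δ : ℂ) + w.1‖ ^ 2 = δ ^ 2 + 2 * δ * w.1.re + ‖w.1‖ ^ 2 := by
    rw [Complex.sq_norm, Complex.sq_norm, Complex.normSq_apply, Complex.normSq_apply]
    simp; ring
  have h2 : -(ε / 32 * ‖w.1‖) ≤ w.1.re := by linarith [hH0 w.2]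
  set y := ‖w.1‖ with hy
  have hy0 : 0 ≤ y := norm_nonneg _
  have h4 : δ * (ε * y) ≤ δ * (1 / 2 * y) := by gcongr
  have h5 : δ * -(ε / 32 * y) ≤ δ * w.1.re := by gcongr
  have h3 : δ * y + δ ^ 2 / 4 ≤ ‖(δ : ℂ) + w.1‖ ^ 2 := by
    rw [h1]
    nlinarith [sq_nonneg (3 / 4 * δ - y), mul_nonneg hδ.le hy0]
  have hne : (δ : ℂ) + w.1 ≠ 0 := by
    intro h
    rw [h] at h3
    simp at h3
    nlinarith [mul_nonneg hδ.le hy0]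
  refine ⟨hne, ?_⟩
  have h6 := norm_siegelToBall_sq hHh hL hδ hne
  set t := ‖(δ : ℂ) + w.1‖ ^ 2 with ht
  have ht0 : 0 < t := by nlinarith [mul_nonneg hδ.le hy0]
  have h7 : ‖siegelToBall L δ w‖ ^ 2 ≤ 1 + ε / 8 := by
    have h8 : 4 * δ * (H w.2 - w.1.re) ≤ 4 * δ * (ε / 32 * y) := by gcongr
    have h9 : ε / 8 * (δ * y) ≤ ε / 8 * t := by gcongr; nlinarith
    refine le_of_mul_le_mul_right ?_ ht0
    nlinarith
  by_contra h
  nlinarith [norm_nonneg (siegelToBall L δ w)]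

theorem exists_siegelToBall_eq {κ : ℝ} (hκ : 0 < κ) {H : V → ℝ}
    (hHh : ∀ (c : ℂ) v, H (c • v) = ‖c‖ ^ 2 * H v) (hHκ : ∀ v, κ * ‖v‖ ^ 2 ≤ H v)
    {L : (ℂ × V) ≃L[ℂ] E} (hL : ∀ w, ‖L w‖ ^ 2 = ‖w.1‖ ^ 2 + H w.2) {δ ε : ℝ} (hδ : 0 < δ)
    (hε : 0 < ε) (hε2 : ε < 1 / 2) {y : E} (hy : ‖y‖ ≤ 1 - ε / 2) :
    ∃ (f : ℂ) (ζ : V), siegelToBall L δ (f, ζ) = y ∧ ‖ζ‖ ^ 2 ≤ 4 / (κ * ε ^ 2) * δ ∧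
      ‖f‖ ≤ 4 / ε * δ ∧ ε / 8 * δ ≤ f.re - H ζ := by
  have hH0 : ∀ v, 0 ≤ H v := fun v => le_trans (by positivity) (hHκ v)
  obtain ⟨⟨a, b⟩, hab⟩ := L.surjective y
  have hsum : ‖a‖ ^ 2 + H b ≤ (1 - ε / 2) ^ 2 := by
    have := hL (a, b)
    rw [hab] at this
    rw [← this]
    gcongr
  have hbn : ‖b‖ ^ 2 ≤ 1 / κ := by
    rw [le_div_iff₀ hκ]
    nlinarith [hHκ b, sq_nonneg ‖a‖]
  have hsq : (1 - ε / 2) ^ 2 ≤ 1 - ε / 2 := by nlinarith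
  have han : ‖a‖ ≤ 1 - ε / 2 := by
    refine abs_le_of_sq_le_sq' ?_ (by linarith) |>.2
    linarith [hH0 b]
  have h1a : ε / 2 ≤ ‖1 + a‖ := by
    have := norm_sub_le (1 + a) a
    rw [add_sub_cancel_right, norm_one] at this
    linarith
  have h1a' : ‖1 + a‖ ≤ 2 := by
    have := norm_add_le 1 a
    rw [norm_one] at this
    linarith
  have h1a0 : 0 < ‖1 + a‖ := by linarith
  have hne : 1 + a ≠ 0 := norm_pos_iff.1 h1a0
  set f : ℂ := δ * (1 - a) / (1 + a) with hf
  set ζ : V := ((√δ : ℂ) / (1 + a)) • b with hζ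
  have hinv : siegelToBall L δ (f, ζ) = y := by
    rw [← hab]; exact siegelToBall_inverse hδ hne
  have hsδ : ‖(√δ : ℂ) / (1 + a)‖ ^ 2 = δ / ‖1 + a‖ ^ 2 := by
    rw [norm_div, div_pow, Complex.norm_real, Real.norm_of_nonneg (Real.sqrt_nonneg _),
      Real.sq_sqrt hδ.le]
  have hζn : ‖ζ‖ ^ 2 ≤ 4 / (κ * ε ^ 2) * δ := by
    rw [hζ, norm_smul, mul_pow, hsδ]
    calc δ / ‖1 + a‖ ^ 2 * ‖b‖ ^ 2 ≤ δ / (ε / 2) ^ 2 * (1 / κ) := by gcongr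
      _ = 4 / (κ * ε ^ 2) * δ := by field_simp; norm_num
  have hfn : ‖f‖ ≤ 4 / ε * δ := by
    rw [hf, norm_div, norm_mul, Complex.norm_real, Real.norm_of_nonneg hδ.le]
    have h1 : ‖1 - a‖ ≤ 2 := by
      have := norm_sub_le 1 a
      rw [norm_one] at this
      linarith
    calc δ * ‖1 - a‖ / ‖1 + a‖ ≤ δ * 2 / (ε / 2) := by gcongr
      _ = _ := by field_simp; norm_num
  have hdiff : ε / 8 * δ ≤ f.re - H ζ := by
    have h1 : f.re = δ * (1 - ‖a‖ ^ 2) / ‖1 + a‖ ^ 2 := by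
      rw [hf, Complex.div_re, Complex.sq_norm, Complex.sq_norm, ← add_div]
      congr 1
      rw [Complex.normSq_apply]
      simp
      ring
    rw [h1, hζ, hHh, hsδ]
    calc ε / 8 * δ = δ * (ε / 2) / 2 ^ 2 := by ring
      _ ≤ δ * (1 - ‖a‖ ^ 2 - H b) / ‖1 + a‖ ^ 2 := by
          have : ε / 2 ≤ 1 - ‖a‖ ^ 2 - H b := by nlinarith
          have : 0 ≤ 1 - ‖a‖ ^ 2 - H b := by linarith
          gcongr
      _ = _ := by ring
  exact ⟨f, ζ, hinv, hζn, hfn, hdiff⟩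

/-- The squeezing map in model coordinates: any region that is trapped in `{κ ‖z‖² ≤ Re u}` and
that agrees near the origin with `{H z + Re P z < Re u}` up to small second order errors can be
squeezed, with the points `(u₀, 0)` for `u₀` close to a small `δ` as centre. -/
theorem exists_squeezing_map_of_model {P : V → ℂ} (hPd : Differentiable ℂ P)
    (hPh : ∀ (c : ℂ) v, P (c • v) = c ^ 2 * P v) {C κ : ℝ}
    (hκ : 0 < κ) (hC : 0 ≤ C) (hPC : ∀ v, ‖P v‖ ≤ C * ‖v‖ ^ 2)
    {H : V → ℝ} (hHh : ∀ (c : ℂ) v, H (c • v) = ‖c‖ ^ 2 * H v)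
    (hHκ : ∀ v, κ * ‖v‖ ^ 2 ≤ H v) (hHC : ∀ v, H v ≤ C * ‖v‖ ^ 2)
    {L : (ℂ × V) ≃L[ℂ] E} (hL : ∀ w, ‖L w‖ ^ 2 = ‖w.1‖ ^ 2 + H w.2)
    {ε : ℝ} (hε : 0 < ε) (hε2 : ε < 1 / 2) :
    ∃ η > (0 : ℝ), ∀ m > (0 : ℝ), ∃ δ₀ > (0 : ℝ), ∀ δ, 0 < δ → δ < δ₀ → ∀ u₀ : ℂ,
      ‖u₀ - δ‖ ≤ η * δ → ∀ D : Set (ℂ × V), (u₀, 0) ∈ D →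
      (∀ w ∈ D, 0 < w.1.re ∧ κ * ‖w.2‖ ^ 2 ≤ w.1.re) →
      (∀ w ∈ D, ‖w.1‖ < m → H w.2 + (P w.2).re ≤ w.1.re + η * (‖w.2‖ ^ 2 + ‖w.1‖)) →
      (∀ w : ℂ × V, ‖w.1‖ < m → ‖w.2‖ < m →
        H w.2 + (P w.2).re + η * (‖w.2‖ ^ 2 + ‖w.1‖) < w.1.re → w ∈ D) →
      ∃ G : ℂ × V → E, DifferentiableOn ℂ G D ∧ InjOn G D ∧ G (u₀, 0) = 0 ∧
        ball 0 (1 - ε) ⊆ G '' D ∧ G '' D ⊆ ball 0 (1 + ε) := by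
  have hH0 : ∀ v, 0 ≤ H v := fun v => le_trans (by positivity) (hHκ v)
  have hP0 : P 0 = 0 := by simpa using hPh 0 0
  have hH00 : H 0 = 0 := by simpa using hHh 0 0
  set C₂ : ℝ := 8 / (κ * ε ^ 2) with hC₂
  set C₁ : ℝ := 4 / ε + C * C₂ with hC₁
  have hC₂0 : 0 < C₂ := by positivity
  have hC₁0 : 0 < C₁ := by positivity
  obtain ⟨η, hη, hη1, hη2, hη3⟩ : ∃ η > (0 : ℝ),
      64 * ((1 + C / κ) * (1 + (1 + 3 * C) / κ) * η) ≤ ε ∧ η ≤ ε / 4 ∧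
        η * (C₁ + C₂) ≤ ε / 32 := by
    have h1 : 0 < 64 * ((1 + C / κ) * (1 + (1 + 3 * C) / κ)) := by positivity
    have h2 : 0 < C₁ + C₂ := by positivity
    refine ⟨min (ε / (64 * ((1 + C / κ) * (1 + (1 + 3 * C) / κ))))
      (min (ε / 4) (ε / 32 / (C₁ + C₂))), by positivity, ?_, ?_, ?_⟩
    · have := min_le_left (ε / (64 * ((1 + C / κ) * (1 + (1 + 3 * C) / κ))))
        (min (ε / 4) (ε / 32 / (C₁ + C₂)))
      rw [le_div_iff₀ h1] at this
      linarith
    · exact (min_le_right _ _).trans (min_le_left _ _)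
    · rw [← le_div_iff₀ h2]
      exact (min_le_right _ _).trans (min_le_right _ _)
  refine ⟨η, hη, fun m hm => ?_⟩
  obtain ⟨g, hgd, hgc, hg1, hgne, hg⟩ := exists_holomorphic_cutoff hη hm
  obtain ⟨τ, hτ, hτ2, hτ3⟩ : ∃ τ > (0 : ℝ), τ ≤ 1 / 2 ∧ 2 * τ * (C * C₂) ≤ ε / 32 := by
    refine ⟨min (1 / 2) (ε / 32 / (2 * (C * C₂ + 1))), by positivity, min_le_left _ _, ?_⟩
    have h2 : 0 < 2 * (C * C₂ + 1) := by positivity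
    have := min_le_right (1 / 2) (ε / 32 / (2 * (C * C₂ + 1)))
    rw [le_div_iff₀ h2] at this
    have h3 : 0 < min (1 / 2) (ε / 32 / (2 * (C * C₂ + 1))) := by positivity
    linarith
  obtain ⟨d, hd, hgd0⟩ : ∃ d > (0 : ℝ), ∀ u : ℂ, ‖u‖ < d → ‖g u ^ 2 - 1‖ < τ := by
    have h1 : ContinuousAt (fun u => g u ^ 2) 0 := hgc.pow 2
    obtain ⟨d, hd, h⟩ := Metric.continuousAt_iff.1 h1 τ hτ
    exact ⟨d, hd, fun u hu => by simpa [hg1, dist_eq_norm] using @h u (by simpa using hu)⟩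
  refine ⟨min (min d m / C₁) (m ^ 2 / C₂), by positivity, fun δ hδ hδ0 u₀ hu₀ D hu₀D ha hb hc => ?_⟩
  have hδ1 : C₁ * δ < min d m := by
    have := hδ0.trans_le (min_le_left _ _)
    rw [lt_div_iff₀ hC₁0] at this
    linarith
  have hδ2 : C₂ * δ < m ^ 2 := by
    have := hδ0.trans_le (min_le_right _ _)
    rw [lt_div_iff₀ hC₂0] at this
    linarith
  set F : ℂ × V → ℂ × V := fun w => (w.1 - P (g w.1 • w.2), g w.1 • w.2) with hF
  have hgD : DifferentiableOn ℂ (fun w : ℂ × V => g w.1) D :=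
    hgd.comp differentiable_fst.differentiableOn (fun w hw => (ha w hw).1)
  have hζD : DifferentiableOn ℂ (fun w : ℂ × V => g w.1 • w.2) D :=
    hgD.smul differentiable_snd.differentiableOn
  have hfD : DifferentiableOn ℂ (fun w : ℂ × V => w.1 - P (g w.1 • w.2)) D :=
    differentiable_fst.differentiableOn.sub (hPd.comp_differentiableOn hζD)
  have hFD : ∀ w ∈ D, (δ : ℂ) + (F w).1 ≠ 0 ∧ ‖siegelToBall L δ (F w)‖ < 1 + ε / 2 := by
    intro w hw
    obtain ⟨h1, h2⟩ := ha w hw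
    obtain ⟨h3, h4, h5⟩ := hg w.1 h1
    refine norm_siegelToBall_le hHh hH0 hL hδ hε hε2
      (shear_estimate hPh hκ hC hPC hHh hHκ hHC hε hε2 hη.le hη1 h1 h2 h3 h4 ?_).1
    rcases lt_or_ge ‖w.1‖ m with h | h
    · exact Or.inl (hb w hw h)
    · exact Or.inr (h5 h)
  have hFinj : ∀ w w', F w = F w' → w = w' := by
    intro w w' h
    simp only [hF, Prod.mk.injEq] at h
    have h1 : w.1 = w'.1 := by
      have h2 := h.1
      rw [h.2] at h2
      exact sub_left_injective h2
    have h2 := h.2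
    rw [h1] at h2
    exact Prod.ext h1 (smul_right_injective V (hgne w'.1) h2)
  set y₀ : E := siegelToBall L δ (F (u₀, 0)) with hy₀
  have hy₀n : ‖y₀‖ ≤ ε / 4 := by
    have h1 : F (u₀, 0) = (u₀, 0) := by simp [hF, hP0]
    have h2 := (hFD _ hu₀D).1
    rw [h1] at h2
    have h3 : ‖y₀‖ ^ 2 = (‖(δ : ℂ) - u₀‖ / ‖(δ : ℂ) + u₀‖) ^ 2 := by
      rw [hy₀, h1, siegelToBall, hL]
      simp [hH00]
    have h4 : ‖y₀‖ = ‖(δ : ℂ) - u₀‖ / ‖(δ : ℂ) + u₀‖ :=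
      (pow_left_inj₀ (norm_nonneg _) (by positivity) two_ne_zero).1 h3
    rw [h4, div_le_iff₀ (norm_pos_iff.2 h2), norm_sub_rev]
    have h5 : 2 * δ ≤ ‖(δ : ℂ) + u₀‖ + ‖u₀ - δ‖ := by
      have := norm_sub_le ((δ : ℂ) + u₀) (u₀ - δ)
      rw [show (δ : ℂ) + u₀ - (u₀ - δ) = ((2 * δ : ℝ) : ℂ) by push_cast; ring,
        Complex.norm_real, Real.norm_of_nonneg (by positivity)] at this
      exact this
    have h6 : η * δ ≤ ε / 4 * δ := by gcongr
    have h7 : δ ≤ ‖(δ : ℂ) + u₀‖ := by nlinarith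
    have h8 : ε / 4 * δ ≤ ε / 4 * ‖(δ : ℂ) + u₀‖ := by gcongr
    linarith
  refine ⟨fun w => siegelToBall L δ (F w) - y₀, ?_, ?_, by simp [hy₀], ?_, ?_⟩
  · refine DifferentiableOn.sub_const ?_ _
    have h1 : DifferentiableOn ℂ (fun w => (((δ : ℂ) - (F w).1) / (δ + (F w).1),
        (2 * (√δ : ℂ) / (δ + (F w).1)) • (F w).2)) D := by
      have h2 : DifferentiableOn ℂ (fun w => (δ : ℂ) + (F w).1) D := hfD.const_add _
      refine DifferentiableOn.prodMk ?_ ?_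
      · exact (hfD.const_sub _).mul (h2.inv fun w hw => (hFD w hw).1)
      · exact ((h2.inv fun w hw => (hFD w hw).1).const_mul _).smul hζD
    exact L.differentiable.comp_differentiableOn h1
  · intro w hw w' hw' h
    exact hFinj _ _ (siegelToBall_injective hδ (hFD w hw).1 (hFD w' hw').1 (sub_left_injective h))
  · intro y hy
    rw [mem_ball_zero_iff] at hy
    have hn : ‖y + y₀‖ ≤ 1 - ε / 2 := by
      have := norm_add_le y y₀
      linarith
    obtain ⟨f, ζ, hinv, hζn, hfn, hdiff⟩ := exists_siegelToBall_eq hκ hHh hHκ hL hδ hε hε2 hn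
    replace hζn : ‖ζ‖ ^ 2 ≤ C₂ / 2 * δ := hζn.trans_eq (by rw [hC₂]; ring)
    obtain ⟨u, hu⟩ : ∃ u, u = f + P ζ := ⟨_, rfl⟩
    have hun : ‖u‖ ≤ C₁ * δ := by
      have h1 := norm_add_le f (P ζ)
      rw [← hu] at h1
      have h2 : C * ‖ζ‖ ^ 2 ≤ C * (C₂ * δ) := by gcongr; nlinarith
      rw [hC₁]
      linarith [hPC ζ]
    have hgu := hgd0 u (hun.trans_lt (hδ1.trans_le (min_le_left _ _)))
    have hgu2 : |‖g u‖ ^ 2 - 1| ≤ τ := by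
      have h1 := abs_norm_sub_norm_le (g u ^ 2) 1
      rw [norm_one, norm_pow] at h1
      linarith
    obtain ⟨z, hgz⟩ : ∃ z, g u • z = ζ := ⟨_, smul_inv_smul₀ (hgne u) ζ⟩
    have hzn : ‖z‖ ^ 2 ≤ C₂ * δ := by
      have h1 : ‖g u‖ ^ 2 * ‖z‖ ^ 2 = ‖ζ‖ ^ 2 := by rw [← hgz, norm_smul, mul_pow]
      have h2 : 1 / 2 ≤ ‖g u‖ ^ 2 := by linarith [(abs_le.1 hgu2).1]
      have h3 : 1 / 2 * ‖z‖ ^ 2 ≤ ‖g u‖ ^ 2 * ‖z‖ ^ 2 := by gcongr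
      linarith
    have hFuz : F (u, z) = (f, ζ) := by simp only [hF, hgz]; rw [hu, add_sub_cancel_right]
    refine ⟨(u, z), hc _ (hun.trans_lt (hδ1.trans_le (min_le_right _ _))) ?_ ?_, ?_⟩
    · exact lt_of_pow_lt_pow_left₀ 2 hm.le (hzn.trans_lt hδ2)
    · simp only
      have h1 : u.re = f.re + (P ζ).re := by simp [hu]
      have h2 : (P z).re - (P ζ).re ≤ τ * (C * (C₂ * δ)) := by
        have h3 : P z - P ζ = -((g u ^ 2 - 1) * P z) := by rw [← hgz, hPh]; ring
        rw [← Complex.sub_re, h3]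
        refine (Complex.re_le_norm _).trans ?_
        rw [norm_neg, norm_mul]
        exact mul_le_mul hgu.le ((hPC z).trans (by gcongr)) (norm_nonneg _) hτ.le
      have h3 : H z - H ζ ≤ τ * (C * (C₂ * δ)) := by
        have h4 : H z - H ζ = -(‖g u‖ ^ 2 - 1) * H z := by rw [← hgz, hHh]; ring
        rw [h4]
        refine mul_le_mul ?_ ((hHC z).trans (by gcongr)) (hH0 z) hτ.le
        linarith [(abs_le.1 hgu2).1]
      have h5 : η * (‖z‖ ^ 2 + ‖u‖) ≤ η * (C₁ + C₂) * δ := by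
        rw [mul_assoc]
        gcongr
        linarith
      have h6 : η * (C₁ + C₂) * δ ≤ ε / 32 * δ := by gcongr
      have h7 : 2 * τ * (C * C₂) * δ ≤ ε / 32 * δ := by gcongr
      have h8 : 0 < ε * δ := by positivity
      linarith
    · simp only [hFuz, hinv, add_sub_cancel_right]
  · rintro _ ⟨w, hw, rfl⟩
    rw [mem_ball_zero_iff]
    have := norm_sub_le (siegelToBall L δ (F w)) y₀
    have := (hFD w hw).2
    simp only
    linarith

end Model

section QuadraticForm

open scoped InnerProductSpace

variable {V : Type*} [NormedAddCommGroup V] [NormedSpace ℂ V]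

theorem complex_smul_eq (c : ℂ) (v : V) : c • v = c.re • v + c.im • (Complex.I • v) := by
  conv_lhs => rw [← Complex.re_add_im c]
  rw [add_smul, mul_smul]
  rfl

/-- The Hermitian part of half a real quadratic form. -/
noncomputable def hermitianPart (A : V →L[ℝ] V →L[ℝ] ℝ) (v : V) : ℝ :=
  (A v v + A (Complex.I • v) (Complex.I • v)) / 4

/-- The complex quadratic form whose real part, together with the Hermitian part, makes up half
a real quadratic form. -/
noncomputable def quadraticPart (A : V →L[ℝ] V →L[ℝ] ℝ) (v : V) : ℂ :=
  ⟨(A v v - A (Complex.I • v) (Complex.I • v)) / 4, - A (Complex.I • v) v / 2⟩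

theorem hermitianPart_add_re_quadraticPart (A : V →L[ℝ] V →L[ℝ] ℝ) (v : V) :
    hermitianPart A v + (quadraticPart A v).re = A v v / 2 := by
  simp only [hermitianPart, quadraticPart]; ring

theorem apply_complex_smul_left (A : V →L[ℝ] V →L[ℝ] ℝ) (c : ℂ) (v w : V) :
    A (c • v) w = c.re * A v w + c.im * A (Complex.I • v) w := by
  rw [complex_smul_eq c v]
  simp only [map_add, map_smul, add_apply, smul_apply, smul_eq_mul]

theorem apply_complex_smul_right (A : V →L[ℝ] V →L[ℝ] ℝ) (c : ℂ) (v w : V) :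
    A v (c • w) = c.re * A v w + c.im * A v (Complex.I • w) := by
  rw [complex_smul_eq c w]
  simp only [map_add, map_smul, smul_eq_mul]

theorem apply_I_smul_smul_left (A : V →L[ℝ] V →L[ℝ] ℝ) (c : ℂ) (v w : V) :
    A (Complex.I • c • v) w = c.re * A (Complex.I • v) w - c.im * A v w := by
  rw [smul_smul, apply_complex_smul_left]
  simp
  ring

theorem apply_I_smul_smul_right (A : V →L[ℝ] V →L[ℝ] ℝ) (c : ℂ) (v w : V) :
    A v (Complex.I • c • w) = c.re * A v (Complex.I • w) - c.im * A v w := by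
  rw [smul_smul, apply_complex_smul_right]
  simp
  ring

theorem hermitianPart_smul {A : V →L[ℝ] V →L[ℝ] ℝ} (hA : ∀ v w, A v w = A w v) (c : ℂ) (v : V) :
    hermitianPart A (c • v) = ‖c‖ ^ 2 * hermitianPart A v := by
  simp only [Complex.sq_norm, Complex.normSq_apply, hermitianPart, apply_complex_smul_left A c,
    apply_complex_smul_right A c, apply_I_smul_smul_left A c, apply_I_smul_smul_right A c,
    hA (Complex.I • v) v]
  ring

theorem quadraticPart_smul {A : V →L[ℝ] V →L[ℝ] ℝ} (hA : ∀ v w, A v w = A w v) (c : ℂ) (v : V) :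
    quadraticPart A (c • v) = c ^ 2 * quadraticPart A v := by
  apply Complex.ext <;>
  · simp only [pow_two, Complex.mul_re, Complex.mul_im, quadraticPart,
      apply_complex_smul_left A c, apply_complex_smul_right A c, apply_I_smul_smul_left A c,
      apply_I_smul_smul_right A c, hA (Complex.I • v) v]
    ring

theorem abs_apply_smul_le (A : V →L[ℝ] V →L[ℝ] ℝ) (a b : ℂ) (ha : ‖a‖ = 1) (hb : ‖b‖ = 1)
    (v w : V) : |A (a • v) (b • w)| ≤ ‖A‖ * (‖v‖ * ‖w‖) := by
  have := A.le_opNorm₂ (a • v) (b • w)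
  rw [norm_smul, norm_smul, ha, hb, one_mul, one_mul, mul_assoc] at this
  exact this

theorem hermitianPart_le (A : V →L[ℝ] V →L[ℝ] ℝ) (v : V) :
    hermitianPart A v ≤ ‖A‖ * ‖v‖ ^ 2 := by
  have h1 := abs_apply_smul_le A 1 1 (by simp) (by simp) v v
  have h2 := abs_apply_smul_le A Complex.I Complex.I (by simp) (by simp) v v
  rw [one_smul] at h1
  rw [hermitianPart, pow_two]
  have := (abs_le.1 h1).2
  have := (abs_le.1 h2).2
  nlinarith [norm_nonneg A, mul_nonneg (norm_nonneg A) (mul_nonneg (norm_nonneg v) (norm_nonneg v))]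

theorem norm_quadraticPart_le (A : V →L[ℝ] V →L[ℝ] ℝ) (v : V) :
    ‖quadraticPart A v‖ ≤ ‖A‖ * ‖v‖ ^ 2 := by
  have h1 := abs_apply_smul_le A 1 1 (by simp) (by simp) v v
  have h2 := abs_apply_smul_le A Complex.I Complex.I (by simp) (by simp) v v
  have h3 := abs_apply_smul_le A Complex.I 1 (by simp) (by simp) v v
  rw [one_smul] at h1 h3
  refine (Complex.norm_le_abs_re_add_abs_im _).trans ?_
  simp only [quadraticPart, pow_two]
  rw [abs_div, abs_div, abs_neg, abs_two, abs_of_pos (by norm_num : (0 : ℝ) < 4)]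
  have := abs_sub (A v v) (A (Complex.I • v) (Complex.I • v))
  linarith

theorem le_hermitianPart {A : V →L[ℝ] V →L[ℝ] ℝ} {κ : ℝ} (h : ∀ v, κ * ‖v‖ ^ 2 ≤ A v v) (v : V) :
    κ / 2 * ‖v‖ ^ 2 ≤ hermitianPart A v := by
  have h1 := h v
  have h2 := h (Complex.I • v)
  rw [norm_smul, Complex.norm_I, one_mul] at h2
  rw [hermitianPart]
  linarith

theorem differentiable_quadraticPart {A : V →L[ℝ] V →L[ℝ] ℝ} (hA : ∀ v w, A v w = A w v) :
    Differentiable ℂ (quadraticPart A) := by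
  let b : V →ₗ[ℂ] V →ₗ[ℂ] ℂ := LinearMap.mk₂ ℂ
    (fun v w => (⟨(A v w - A (Complex.I • v) (Complex.I • w)) / 4,
      -(A (Complex.I • v) w + A v (Complex.I • w)) / 4⟩ : ℂ))
    (fun v v' w => by apply Complex.ext <;> simp <;> ring)
    (fun c v w => by
      apply Complex.ext <;>
      · simp [apply_complex_smul_left A c, apply_I_smul_smul_left A c]
        ring)
    (fun v w w' => by apply Complex.ext <;> simp <;> ring)
    (fun c v w => by
      apply Complex.ext <;>
      · simp [apply_complex_smul_right A c, apply_I_smul_smul_right A c]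
        ring)
  have hb : ∀ v w, ‖b v w‖ ≤ ‖A‖ * ‖v‖ * ‖w‖ := by
    intro v w
    have h1 := abs_apply_smul_le A 1 1 (by simp) (by simp) v w
    have h2 := abs_apply_smul_le A Complex.I Complex.I (by simp) (by simp) v w
    have h3 := abs_apply_smul_le A Complex.I 1 (by simp) (by simp) v w
    have h4 := abs_apply_smul_le A 1 Complex.I (by simp) (by simp) v w
    rw [one_smul] at h3 h4
    rw [one_smul, one_smul] at h1
    refine (Complex.norm_le_abs_re_add_abs_im _).trans ?_
    simp only [b, LinearMap.mk₂_apply]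
    rw [abs_div, abs_div, abs_neg, abs_of_pos (by norm_num : (0 : ℝ) < 4)]
    have := abs_sub (A v w) (A (Complex.I • v) (Complex.I • w))
    have := abs_add_le (A (Complex.I • v) w) (A v (Complex.I • w))
    linarith
  have h : quadraticPart A = fun v => b.mkContinuous₂ ‖A‖ hb v v := by
    ext v
    simp only [LinearMap.mkContinuous₂_apply, b, LinearMap.mk₂_apply, quadraticPart,
      hA v (Complex.I • v)]
    congr 1
    ring
  rw [h]
  fun_prop

end QuadraticForm

/-- A positive definite Hermitian part is the square norm of a linear automorphism. -/
theorem exists_norm_sq_eq_hermitianPart {V : Type*} [NormedAddCommGroup V] [InnerProductSpace ℂ V]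
    [FiniteDimensional ℂ V] {A : V →L[ℝ] V →L[ℝ] ℝ} (hA : ∀ v w, A v w = A w v) {κ : ℝ}
    (hκ : 0 < κ) (hpos : ∀ v, κ * ‖v‖ ^ 2 ≤ A v v) :
    ∃ M : V ≃L[ℂ] V, ∀ v, ‖M v‖ ^ 2 = hermitianPart A v := by
  have : CompleteSpace V := FiniteDimensional.complete ℂ V
  let b : V →ₗ⋆[ℂ] V →ₗ[ℂ] ℂ := LinearMap.mk₂'ₛₗ (starRingEnd ℂ) (RingHom.id ℂ)
    (fun v w => (⟨(A v w + A (Complex.I • v) (Complex.I • w)) / 4,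
      (A (Complex.I • v) w - A v (Complex.I • w)) / 4⟩ : ℂ))
    (fun v v' w => by apply Complex.ext <;> simp <;> ring)
    (fun c v w => by
      apply Complex.ext <;>
      · simp [apply_complex_smul_left A c, apply_I_smul_smul_left A c]
        ring)
    (fun v w w' => by apply Complex.ext <;> simp <;> ring)
    (fun c v w => by
      apply Complex.ext <;>
      · simp [apply_complex_smul_right A c, apply_I_smul_smul_right A c]
        ring)
  have hb : ∀ v w, ‖b v w‖ ≤ ‖A‖ * ‖v‖ * ‖w‖ := by
    intro v w
    have h1 := abs_apply_smul_le A 1 1 (by simp) (by simp) v w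
    have h2 := abs_apply_smul_le A Complex.I Complex.I (by simp) (by simp) v w
    have h3 := abs_apply_smul_le A Complex.I 1 (by simp) (by simp) v w
    have h4 := abs_apply_smul_le A 1 Complex.I (by simp) (by simp) v w
    rw [one_smul] at h3 h4
    rw [one_smul, one_smul] at h1
    refine (Complex.norm_le_abs_re_add_abs_im _).trans ?_
    simp only [b, LinearMap.mk₂'ₛₗ_apply]
    rw [abs_div, abs_div, abs_of_pos (by norm_num : (0 : ℝ) < 4)]
    have := abs_add_le (A v w) (A (Complex.I • v) (Complex.I • w))
    have := abs_sub (A (Complex.I • v) w) (A v (Complex.I • w))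
    linarith
  let T : V →L[ℂ] V := InnerProductSpace.continuousLinearMapOfBilin (b.mkContinuous₂ ‖A‖ hb)
  have hT : ∀ v w, inner ℂ (T v) w = b v w := fun v w => by
    simp only [T, InnerProductSpace.continuousLinearMapOfBilin_apply,
      LinearMap.mkContinuous₂_apply]
  have hTre : ∀ v, (b v v).re = hermitianPart A v := fun v => by
    simp only [b, LinearMap.mk₂'ₛₗ_apply, hermitianPart]
  have hTpos : T.IsPositive := by
    refine ⟨fun v w => ?_, fun v => ?_⟩
    · change inner ℂ (T v) w = inner ℂ v (T w)
      rw [← inner_conj_symm v (T w), hT, hT]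
      simp only [b, LinearMap.mk₂'ₛₗ_apply]
      apply Complex.ext
      · simp [hA w v, hA (Complex.I • w) (Complex.I • v)]
      · simp [hA w (Complex.I • v), hA (Complex.I • w) v]; ring
    · change 0 ≤ (inner ℂ (T v) v).re
      rw [hT, hTre]
      exact le_trans (by positivity) (le_hermitianPart hpos v)
  rw [← ContinuousLinearMap.nonneg_iff_isPositive] at hTpos
  set S := CFC.sqrt T with hS
  have hSS : S * S = T := CFC.sqrt_mul_sqrt_self T hTpos
  have hSpos : S.IsPositive :=
    (ContinuousLinearMap.nonneg_iff_isPositive S).1 (CFC.sqrt_nonneg T)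
  have hSn : ∀ v, ‖S v‖ ^ 2 = hermitianPart A v := fun v => by
    rw [← hTre, ← hT, ← hSS, mul_apply_eq_comp, hSpos.inner_left_eq_inner_right,
      inner_self_eq_norm_sq_to_K]
    norm_cast
  have hinj : Function.Injective S.toLinearMap := by
    rw [← LinearMap.ker_eq_bot, LinearMap.ker_eq_bot']
    intro v hv
    have h1 : ‖S v‖ ^ 2 = 0 := by
      rw [show S v = 0 from hv]; simp
    rw [hSn] at h1
    have h2 := le_hermitianPart hpos v
    by_contra h
    have : 0 < κ / 2 * ‖v‖ ^ 2 := by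
      have := norm_pos_iff.2 h
      positivity
    linarith
  exact ⟨(LinearEquiv.ofInjectiveEndo S.toLinearMap hinj).toContinuousLinearEquiv, hSn⟩

/-- Second order Taylor expansion of a `C²` function, uniformly in the base point. -/
theorem exists_taylor_estimate {E : Type*} [NormedAddCommGroup E] [NormedSpace ℝ E] {ρ : E → ℝ}
    {p : E} (hρ : ContDiffAt ℝ 2 ρ p) {η : ℝ} (hη : 0 < η) :
    ∃ r > 0, ∀ x ∈ ball p r, ‖fderiv ℝ ρ x - fderiv ℝ ρ p‖ ≤ η ∧ ∀ h, ‖h‖ < r →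
      |ρ (x + h) - ρ x - fderiv ℝ ρ x h - fderiv ℝ (fderiv ℝ ρ) p h h / 2| ≤ η * ‖h‖ ^ 2 := by
  set A := fderiv ℝ (fderiv ℝ ρ) p with hAdef
  have hsymm : ∀ v w, A v w = A w v := fun v w => (hρ.isSymmSndFDerivAt (by simp)) v w
  have hd : ContDiffAt ℝ 1 (fderiv ℝ ρ) p := hρ.fderiv_right (by norm_num)
  have hstrict : HasStrictFDerivAt (fderiv ℝ ρ) A p := hd.hasStrictFDerivAt one_ne_zero
  obtain ⟨s, hs, hsb⟩ : ∃ s > 0, ∀ x ∈ ball p s, DifferentiableAt ℝ ρ x := by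
    have h := (hρ.eventually (by simp)).mono fun x hx =>
      (hx.differentiableAt (by norm_num) : DifferentiableAt ℝ ρ x)
    exact Metric.eventually_nhds_iff_ball.1 h
  obtain ⟨t, ht, htb⟩ : ∃ t > 0, ∀ x ∈ ball p t, ‖fderiv ℝ ρ x - fderiv ℝ ρ p‖ ≤ η := by
    have h := Metric.continuousAt_iff.1 hd.continuousAt η hη
    obtain ⟨t, ht, h⟩ := h
    exact ⟨t, ht, fun x hx => by rw [← dist_eq_norm]; exact (h hx).le⟩
  obtain ⟨u, hu, hub⟩ : ∃ u > 0, ∀ x ∈ ball p u, ∀ y ∈ ball p u,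
      ‖fderiv ℝ ρ x - fderiv ℝ ρ y - A (x - y)‖ ≤ η * ‖x - y‖ := by
    have h := hstrict.isLittleO.def hη
    rw [nhds_prod_eq, Filter.eventually_prod_self_iff'] at h
    obtain ⟨U, hU, h⟩ := h
    obtain ⟨u, hu, hub⟩ := Metric.mem_nhds_iff.1 hU
    exact ⟨u, hu, fun x hx y hy => h x (hub hx) y (hub hy)⟩
  refine ⟨min t (min s u / 2), by positivity, fun x hx => ⟨htb x ?_, fun h hh => ?_⟩⟩
  · exact ball_subset_ball (min_le_left _ _) hx
  have hr : min t (min s u / 2) ≤ min s u / 2 := min_le_right _ _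
  have hmem : ∀ k, ‖k‖ ≤ ‖h‖ → x + k ∈ ball p (min s u) := fun k hk => by
    have h1 := mem_ball_iff_norm.1 hx
    have h2 := norm_add_le (x - p) k
    rw [mem_ball_iff_norm, add_sub_right_comm]
    linarith
  let g : E → ℝ := fun k => ρ (x + k) - fderiv ℝ ρ x k - A k k / 2
  have hg : ∀ k ∈ closedBall (0 : E) ‖h‖,
      HasFDerivWithinAt g (fderiv ℝ ρ (x + k) - fderiv ℝ ρ x - A k) (closedBall 0 ‖h‖) k := by
    intro k hk
    have h1 : HasFDerivAt (fun k => ρ (x + k)) (fderiv ℝ ρ (x + k)) k := by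
      have := (hsb _ (ball_subset_ball (min_le_left _ _)
        (hmem k (mem_closedBall_zero_iff.1 hk)))).hasFDerivAt
      exact (hasFDerivAt_comp_add_left x).2 this
    have h2 : HasFDerivAt (fun k => A k k / 2) (A k) k := by
      have h3 := (A.hasFDerivAt (x := k)).clm_apply (hasFDerivAt_id k)
      have h4 := h3.mul_const (1 / 2 : ℝ)
      refine (h4.congr_fderiv ?_).congr_of_eventuallyEq ?_
      · ext v
        simp [hsymm v k]
        ring
      · exact Filter.Eventually.of_forall fun v => by simp; ring
    exact ((h1.sub (fderiv ℝ ρ x).hasFDerivAt).sub h2).hasFDerivWithinAt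
  have hbound : ∀ k ∈ closedBall (0 : E) ‖h‖,
      ‖fderiv ℝ ρ (x + k) - fderiv ℝ ρ x - A k‖ ≤ η * ‖h‖ := by
    intro k hk
    have hk' := mem_closedBall_zero_iff.1 hk
    have h1 := hub (x + k) (ball_subset_ball (min_le_right _ _) (hmem k hk')) x
      (by simpa using ball_subset_ball (min_le_right _ _) (hmem 0 (by simp)))
    rw [add_sub_cancel_left] at h1
    exact h1.trans (mul_le_mul_of_nonneg_left hk' hη.le)
  have key := (convex_closedBall (0 : E) ‖h‖).norm_image_sub_le_of_norm_hasFDerivWithin_le hg hbound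
    (mem_closedBall_self (norm_nonneg _)) (mem_closedBall_zero_iff.2 le_rfl)
  simp only [g, add_zero, map_zero, sub_zero, zero_div, Real.norm_eq_abs] at key
  rw [pow_two, ← mul_assoc]
  convert key using 2
  ring

section Geometry

open scoped InnerProductSpace
open Filter Topology

variable {E : Type*} [NormedAddCommGroup E] [InnerProductSpace ℂ E]

/-- The real part of the inner product with a fixed vector, as a real functional. -/
noncomputable def reInner (ν : E) : E →L[ℝ] ℝ :=
  Complex.reCLM ∘L (innerSL ℂ ν).restrictScalars ℝ

theorem reInner_apply (ν h : E) : reInner ν h = (inner ℂ ν h).re := rfl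

theorem abs_reInner_le {ν : E} (hν : ‖ν‖ = 1) (h : E) : |reInner ν h| ≤ ‖h‖ := by
  rw [reInner_apply]
  refine (Complex.abs_re_le_norm _).trans ((norm_inner_le_norm ν h).trans ?_)
  rw [hν, one_mul]

theorem reInner_self {ν : E} (hν : ‖ν‖ = 1) : reInner ν ν = 1 := by
  rw [reInner_apply, inner_self_eq_norm_sq_to_K, hν]
  simp

/-- The first order condition at `p` for `{ρ < 0}` to lie, near `p`, in a ball of radius `R`
whose outer unit normal at `p` is `ν`. -/
theorem exists_eq_mul_reInner {ν : E} {R : ℝ} (hR : 0 < R) {d : E →L[ℝ] ℝ} (hd : d ≠ 0)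
    {A : E →L[ℝ] E →L[ℝ] ℝ} {ρ : E → ℝ} {p : E}
    (hT : ∀ η > 0, ∃ r > 0, ∀ h, ‖h‖ < r → |ρ (p + h) - d h - A h h / 2| ≤ η * ‖h‖ ^ 2)
    {r₀ : ℝ} (hr₀ : 0 < r₀)
    (hball : ∀ h, ‖h‖ < r₀ → ρ (p + h) < 0 → ‖h‖ ^ 2 + 2 * R * reInner ν h < 0) :
    ∃ l > 0, ∀ h, d h = l * reInner ν h := by
  have key : ∀ v, d v < 0 → reInner ν v < 0 := by
    intro v hv
    obtain ⟨r, hr, hT⟩ := hT 1 one_pos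
    have h1 : ∀ᶠ t in 𝓝[>] (0 : ℝ), ‖t • v‖ < min r r₀ :=
      ((by fun_prop : Continuous fun t : ℝ => ‖t • v‖).tendsto' 0 0 (by simp)).mono_left
        nhdsWithin_le_nhds |>.eventually_lt_const (lt_min hr hr₀)
    have h2 : ∀ᶠ t in 𝓝[>] (0 : ℝ), d v + t * (A v v / 2 + ‖v‖ ^ 2) < 0 :=
      ((by fun_prop : Continuous fun t : ℝ => d v + t * (A v v / 2 + ‖v‖ ^ 2)).tendsto' 0 (d v)
        (by simp)).mono_left nhdsWithin_le_nhds |>.eventually_lt_const hv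
    obtain ⟨t, ⟨h1, h2⟩, ht⟩ := ((h1.and h2).and self_mem_nhdsWithin).exists
    have ht : 0 < t := ht
    have h3 := (abs_le.1 (hT (t • v) (h1.trans_le (min_le_left _ _)))).2
    have h4 := hball (t • v) (h1.trans_le (min_le_right _ _))
    simp only [map_smul, smul_apply, smul_eq_mul, norm_smul, mul_pow,
      Real.norm_eq_abs, sq_abs] at h3 h4
    have h5 := mul_neg_of_pos_of_neg ht h2
    have h6 := h4 (by nlinarith)
    have h7 : t * reInner ν v < 0 := by
      have : 0 ≤ t ^ 2 * ‖v‖ ^ 2 := by positivity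
      by_contra h
      have : 0 ≤ 2 * R * (t * reInner ν v) := by
        have := not_lt.1 h
        positivity
      linarith
    exact (pos_iff_neg_of_mul_neg h7).1 ht
  obtain ⟨v, hv⟩ : ∃ v, d v = -1 := by
    obtain ⟨v, hv⟩ := DFunLike.ne_iff.1 hd
    exact ⟨(-(d v)⁻¹) • v, by
      rw [map_smul, smul_eq_mul, neg_mul, inv_mul_cancel₀ hv]⟩
  have hker : ∀ u, d u = 0 → reInner ν u = 0 := by
    intro u hu
    by_contra h
    have := key (v + (-(reInner ν v) / reInner ν u) • u) (by simp [hu, hv])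
    rw [map_add, map_smul, smul_eq_mul, div_mul_cancel₀ _ h] at this
    linarith
  have hv' := key v (by rw [hv]; norm_num)
  refine ⟨1 / -reInner ν v, by have := neg_pos.2 hv'; positivity, fun h => ?_⟩
  have h1 := hker (h + d h • v) (by simp [hv])
  rw [map_add, map_smul, smul_eq_mul] at h1
  rw [eq_neg_of_add_eq_zero_left h1]
  have hne := hv'.ne
  field_simp

/-- The second order condition at `p` for `{ρ < 0}` to lie, near `p`, in a ball of radius `R`
whose outer unit normal at `p` is `ν`. -/
theorem le_hessian_of_reInner_eq_zero {ν : E} (hν : ‖ν‖ = 1) {R : ℝ} (hR : 0 < R)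
    {A : E →L[ℝ] E →L[ℝ] ℝ} {ρ : E → ℝ} {p : E} {l : ℝ} (hl : 0 < l)
    (hT : ∀ η > 0, ∃ r > 0, ∀ h, ‖h‖ < r →
      |ρ (p + h) - l * reInner ν h - A h h / 2| ≤ η * ‖h‖ ^ 2)
    {r₀ : ℝ} (hr₀ : 0 < r₀)
    (hball : ∀ h, ‖h‖ < r₀ → ρ (p + h) < 0 → ‖h‖ ^ 2 + 2 * R * reInner ν h < 0)
    {v : E} (hv : reInner ν v = 0) : l / R * ‖v‖ ^ 2 ≤ A v v := by
  have key : ∀ w, l * reInner ν w + A v v / 2 < 0 → ‖v‖ ^ 2 + 2 * R * reInner ν w ≤ 0 := by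
    intro w hw
    set η := -(l * reInner ν w + A v v / 2) / (2 * (‖v‖ ^ 2 + 1)) with hη
    have hη0 : 0 < η := by have := neg_pos.2 hw; positivity
    have hη1 : l * reInner ν w + A v v / 2 + η * ‖v‖ ^ 2 < 0 := by
      have h1 : η * (‖v‖ ^ 2 + 1) = -(l * reInner ν w + A v v / 2) / 2 := by
        rw [hη]; field_simp
      nlinarith
    obtain ⟨r, hr, hT⟩ := hT η hη0
    have h1 : ∀ᶠ t in 𝓝[>] (0 : ℝ), ‖t • (v + t • w)‖ < min r r₀ :=
      ((by fun_prop : Continuous fun t : ℝ => ‖t • (v + t • w)‖).tendsto' 0 0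
        (by simp)).mono_left nhdsWithin_le_nhds |>.eventually_lt_const (lt_min hr hr₀)
    have h2 : ∀ᶠ t in 𝓝[>] (0 : ℝ), l * reInner ν w + A (v + t • w) (v + t • w) / 2
        + η * ‖v + t • w‖ ^ 2 < 0 :=
      ((by fun_prop : Continuous fun t : ℝ => l * reInner ν w + A (v + t • w) (v + t • w) / 2
        + η * ‖v + t • w‖ ^ 2).tendsto' 0 (l * reInner ν w + A v v / 2 + η * ‖v‖ ^ 2)
        (by simp)).mono_left nhdsWithin_le_nhds |>.eventually_lt_const hη1
    have h3 : ∀ᶠ t in 𝓝[>] (0 : ℝ), ‖v + t • w‖ ^ 2 + 2 * R * reInner ν w ≤ 0 := by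
      filter_upwards [h1, h2, self_mem_nhdsWithin] with t h1 h2 (ht : 0 < t)
      have h3 := (abs_le.1 (hT (t • (v + t • w)) (h1.trans_le (min_le_left _ _)))).2
      have h4 := hball (t • (v + t • w)) (h1.trans_le (min_le_right _ _))
      have h5 : reInner ν (t • (v + t • w)) = t ^ 2 * reInner ν w := by
        simp only [map_smul, map_add, hv, smul_eq_mul]; ring
      have h6 : A (t • (v + t • w)) (t • (v + t • w)) =
          t ^ 2 * A (v + t • w) (v + t • w) := by
        rw [map_smul, map_smul, smul_apply, smul_eq_mul, smul_eq_mul]; ring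
      have h7 : ‖t • (v + t • w)‖ ^ 2 = t ^ 2 * ‖v + t • w‖ ^ 2 := by
        rw [norm_smul, mul_pow, Real.norm_eq_abs, sq_abs]
      rw [h5, h6, h7] at h3
      rw [h5, h7] at h4
      have h8 := mul_neg_of_pos_of_neg (pow_pos ht 2) h2
      have h9 := h4 (by linarith)
      by_contra h
      have := mul_pos (pow_pos ht 2) (not_le.1 h)
      linarith
    refine le_of_tendsto (((by fun_prop : Continuous fun t : ℝ =>
      ‖v + t • w‖ ^ 2 + 2 * R * reInner ν w).tendsto' 0 _ (by simp)).mono_left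
        nhdsWithin_le_nhds) h3
  by_contra! h
  have h1 : A v v / (2 * l) < ‖v‖ ^ 2 / (2 * R) := by
    rw [div_mul_eq_mul_div, lt_div_iff₀ hR] at h
    rw [div_lt_div_iff₀ (by positivity) (by positivity)]
    linarith
  obtain ⟨s, hs1, hs2⟩ := exists_between h1
  rw [div_lt_iff₀ (by positivity)] at hs1
  rw [lt_div_iff₀ (by positivity)] at hs2
  have h2 : reInner ν (-s • ν) = -s := by
    rw [map_smul, reInner_self hν, smul_eq_mul, mul_one]
  have := key (-s • ν) (by rw [h2]; linarith)
  rw [h2] at this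
  linarith

theorem le_apply_self {ν : E} (hν : ‖ν‖ = 1) {A : E →L[ℝ] E →L[ℝ] ℝ} {κ : ℝ} (hκ : 0 ≤ κ)
    (hA : ∀ v, reInner ν v = 0 → κ * ‖v‖ ^ 2 ≤ A v v) (h : E) :
    κ * ‖h‖ ^ 2 - (2 * κ + 3 * ‖A‖) * (|reInner ν h| * ‖h‖) ≤ A h h := by
  set s := reInner ν h with hs
  have hsh : |s| ≤ ‖h‖ := abs_reInner_le hν h
  have h1 := hA (h - s • ν) (by rw [map_sub, map_smul, reInner_self hν, smul_eq_mul, ← hs]; ring)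
  have h2 : ‖h‖ - |s| ≤ ‖h - s • ν‖ := by
    have := norm_sub_norm_le h (s • ν)
    rwa [norm_smul, hν, mul_one, Real.norm_eq_abs] at this
  have h3 : κ * (‖h‖ - |s|) ^ 2 ≤ κ * ‖h - s • ν‖ ^ 2 := by gcongr
  have h4 : A (h - s • ν) (h - s • ν) = A h h - s * A h ν - s * A ν h + s ^ 2 * A ν ν := by
    simp only [map_sub, map_smul, sub_apply, smul_apply, smul_eq_mul]; ring
  have hb : ∀ v w, |A v w| ≤ ‖A‖ * ‖v‖ * ‖w‖ := fun v w => A.le_opNorm₂ v w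
  have h5 : |s * A h ν| ≤ ‖A‖ * (|s| * ‖h‖) := by
    have := hb h ν
    rw [hν, mul_one] at this
    rw [abs_mul]
    nlinarith [abs_nonneg s]
  have h6 : |s * A ν h| ≤ ‖A‖ * (|s| * ‖h‖) := by
    have := hb ν h
    rw [hν, mul_one] at this
    rw [abs_mul]
    nlinarith [abs_nonneg s]
  have h7 : |s ^ 2 * A ν ν| ≤ ‖A‖ * (|s| * ‖h‖) := by
    have h8 := hb ν ν
    rw [hν, mul_one, mul_one] at h8
    rw [abs_mul, abs_pow, pow_two]
    calc |s| * |s| * |A ν ν| ≤ |s| * ‖h‖ * ‖A‖ := by gcongr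
      _ = _ := by ring
  rw [h4] at h1
  have := neg_abs_le (s * A h ν)
  have := neg_abs_le (s * A ν h)
  have := le_abs_self (s ^ 2 * A ν ν)
  nlinarith [mul_nonneg hκ (sq_nonneg s), sq_abs s]

/-- Strict convexity in a neighbourhood of `p` together with containment in a ball bounds a set
by paraboloids at the boundary points close to `p`. -/
theorem exists_forall_mul_norm_sq_le {ν : E} (hν : ‖ν‖ = 1) {R : ℝ} (hR : 0 < R)
    {d : E → E →L[ℝ] ℝ} {A : E →L[ℝ] E →L[ℝ] ℝ} {ρ : E → ℝ} {p : E} {l : ℝ} (hl : 0 < l)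
    (hdp : ∀ h, d p h = l * reInner ν h)
    (hT : ∀ η > 0, ∃ r > 0, ∀ x ∈ ball p r, ‖d x - d p‖ ≤ η ∧ ∀ h, ‖h‖ < r →
      |ρ (x + h) - ρ x - d x h - A h h / 2| ≤ η * ‖h‖ ^ 2)
    {κ : ℝ} (hκ : 0 < κ) (hA : ∀ v, reInner ν v = 0 → κ * ‖v‖ ^ 2 ≤ A v v)
    {Ω : Set E} {r₀ : ℝ} (hr₀ : 0 < r₀) (hΩ : ∀ x ∈ Ω, x ∈ ball p r₀ → ρ x < 0)
    (hball : ∀ h, p + h ∈ Ω → ‖h‖ ^ 2 + 2 * R * reInner ν h < 0) :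
    ∃ μ > 0, ∃ r > 0, ∀ x ∈ ball p r, ρ x = 0 → ∀ h, x + h ∈ Ω → μ * ‖h‖ ^ 2 ≤ -d x h := by
  set K := (2 * κ + 3 * ‖A‖) / l with hK
  have hK0 : 0 < K := by positivity
  set θ := min (κ / 16) (κ / (8 * K)) with hθ
  have hθ0 : 0 < θ := by positivity
  have hθ1 : θ + K * θ / 2 ≤ κ / 8 := by
    have h1 : θ ≤ κ / 16 := min_le_left _ _
    have h2 : K * θ ≤ K * (κ / (8 * K)) := by gcongr; exact min_le_right _ _
    have h3 : K * (κ / (8 * K)) = κ / 8 := by field_simp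
    linarith
  obtain ⟨r, hr, hT1⟩ := hT θ hθ0
  set r₁ := min r (min (1 / K) (r₀ / 2)) with hr₁
  have hr₁0 : 0 < r₁ := by positivity
  set k := l / (2 * R) with hk
  have hk0 : 0 < k := by positivity
  obtain ⟨r', hr', hT2⟩ := hT (k * r₁ / 16) (by positivity)
  set r₂ := min (min r r') (min (r₁ / 2) (k * r₁ ^ 2 / (16 * l))) with hr₂
  have hr₂0 : 0 < r₂ := by positivity
  refine ⟨min (κ / 4) (k / 8), by positivity, r₂, hr₂0, fun x hx hρx h hxh => ?_⟩
  have hxr : x ∈ ball p r := ball_subset_ball ((min_le_left _ _).trans (min_le_left _ _)) hx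
  have hxr' : x ∈ ball p r' := ball_subset_ball ((min_le_left _ _).trans (min_le_right _ _)) hx
  rw [mem_ball_iff_norm] at hx
  have hx1 : ‖x - p‖ < r₁ / 2 := hx.trans_le ((min_le_right _ _).trans (min_le_left _ _))
  have hx2 : ‖x - p‖ < k * r₁ ^ 2 / (16 * l) :=
    hx.trans_le ((min_le_right _ _).trans (min_le_right _ _))
  have hop : ∀ y h, |d y h - d p h| ≤ ‖d y - d p‖ * ‖h‖ := fun y h => (d y - d p).le_opNorm h
  rcases lt_or_ge ‖h‖ r₁ with hh | hh
  · obtain ⟨h1, h2⟩ := hT1 x hxr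
    have h3 := (abs_le.1 (h2 h (hh.trans_le (min_le_left _ _)))).1
    have hr₁2 : r₁ ≤ r₀ / 2 := (min_le_right _ _).trans (min_le_right _ _)
    have h4 : ρ (x + h) < 0 := by
      refine hΩ _ hxh ?_
      rw [mem_ball_iff_norm, add_sub_right_comm]
      have := norm_add_le (x - p) h
      linarith
    have h5 := le_apply_self hν hκ.le hA h
    have h6 : l * |reInner ν h| ≤ |d x h| + θ * ‖h‖ := by
      have h7 := hop x h
      rw [← abs_of_pos hl, ← abs_mul, ← hdp]
      have h8 := abs_sub_abs_le_abs_sub (d p h) (d x h)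
      rw [abs_sub_comm] at h8
      nlinarith [norm_nonneg h]
    have h7 : (2 * κ + 3 * ‖A‖) * (|reInner ν h| * ‖h‖) ≤ K * (|d x h| + θ * ‖h‖) * ‖h‖ := by
      rw [hK, ← mul_assoc]
      gcongr ?_ * _
      rw [div_mul_eq_mul_div, le_div_iff₀ hl, mul_assoc]
      gcongr
      linarith
    have hKh : K * ‖h‖ ≤ 1 := by
      have h8 : ‖h‖ ≤ 1 / K := hh.le.trans ((min_le_right _ _).trans (min_le_left _ _))
      rwa [le_div_iff₀ hK0, mul_comm] at h8
    have h8 : K * ‖h‖ * |d x h| ≤ |d x h| := by nlinarith [abs_nonneg (d x h)]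
    have h9 : (θ + K * θ / 2) * ‖h‖ ^ 2 ≤ κ / 8 * ‖h‖ ^ 2 := by gcongr
    have h10 : 3 / 8 * κ * ‖h‖ ^ 2 ≤ -d x h + |d x h| / 2 := by nlinarith
    have h11 : min (κ / 4) (k / 8) * ‖h‖ ^ 2 ≤ κ / 4 * ‖h‖ ^ 2 := by
      gcongr; exact min_le_left _ _
    have h12 : 0 ≤ κ * ‖h‖ ^ 2 := by positivity
    rcases abs_cases (d x h) with ⟨h13, h14⟩ | ⟨h13, h14⟩ <;> rw [h13] at h10 <;> linarith
  · have h1 := hball (x - p + h) (by rwa [← add_assoc, add_sub_cancel])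
    rw [map_add] at h1
    have h2 : (‖h‖ / 2) ^ 2 ≤ ‖x - p + h‖ ^ 2 := by
      have := norm_sub_norm_le h (-(x - p))
      rw [norm_neg, sub_neg_eq_add, add_comm h] at this
      gcongr
      linarith
    have h3 := (abs_le.1 (abs_reInner_le hν (x - p))).2
    have h4 := (abs_le.1 (hop x h)).2
    have h5 : ‖d x - d p‖ * ‖h‖ ≤ k * r₁ / 16 * ‖h‖ := by
      gcongr; exact (hT2 x hxr').1
    have h6 : k * r₁ / 16 * ‖h‖ ≤ k / 16 * ‖h‖ ^ 2 := by
      have : k * ‖h‖ * r₁ ≤ k * ‖h‖ * ‖h‖ := by gcongr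
      nlinarith
    have h7 : l * ‖x - p‖ ≤ k / 16 * ‖h‖ ^ 2 := by
      rw [lt_div_iff₀ (by positivity)] at hx2
      have : k * r₁ ^ 2 ≤ k * ‖h‖ ^ 2 := by gcongr
      linarith
    have h8 : k * ‖x - p + h‖ ^ 2 + l * (reInner ν (x - p) + reInner ν h) ≤ 0 := by
      have h9 : l = 2 * R * k := by rw [hk]; field_simp
      have := mul_nonpos_of_nonneg_of_nonpos hk0.le h1.le
      rw [h9]
      linarith
    have h9 : min (κ / 4) (k / 8) * ‖h‖ ^ 2 ≤ k / 8 * ‖h‖ ^ 2 := by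
      gcongr; exact min_le_right _ _
    rw [hdp] at h4
    have h10 : l * -‖x - p‖ ≤ l * reInner ν (x - p) := by
      have := (abs_le.1 (abs_reInner_le hν (x - p))).1
      gcongr
    have h11 : k * (‖h‖ / 2) ^ 2 ≤ k * ‖x - p + h‖ ^ 2 := by gcongr
    linarith

theorem coe_orthogonalProjectionOnto_span_singleton {ν : E} (hν : ‖ν‖ = 1) (h : E) :
    (((ℂ ∙ ν)ᗮ.orthogonalProjectionOnto h : (ℂ ∙ ν)ᗮ) : E) = h - (inner ℂ ν h) • ν := by
  rw [Submodule.orthogonalProjectionOnto_orthogonal]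
  simp [Submodule.starProjection_unit_singleton ℂ hν]

theorem norm_sq_eq_norm_inner_sq_add {ν : E} (hν : ‖ν‖ = 1) (h : E) :
    ‖h‖ ^ 2 = ‖inner ℂ ν h‖ ^ 2 + ‖(ℂ ∙ ν)ᗮ.orthogonalProjectionOnto h‖ ^ 2 := by
  rw [Submodule.norm_sq_eq_add_norm_sq_projection h (ℂ ∙ ν)]
  congr 2
  have h1 : ((ℂ ∙ ν).orthogonalProjectionOnto h : E) = inner ℂ ν h • ν :=
    Submodule.starProjection_unit_singleton ℂ hν h
  rw [← Submodule.norm_coe, h1, norm_smul, hν, mul_one]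

/-- A functional which does not vanish on `ν`, together with the orthogonal projection along `ν`,
provides linear coordinates. -/
theorem exists_coordinates {ν : E} (hν : ‖ν‖ = 1) {a : E →L[ℂ] ℂ} (ha : a ν ≠ 0) :
    ∃ Φ : E ≃L[ℂ] ℂ × (ℂ ∙ ν)ᗮ, ∀ h, Φ h = (a h, (ℂ ∙ ν)ᗮ.orthogonalProjectionOnto h) := by
  let f : ℂ × (ℂ ∙ ν)ᗮ →L[ℂ] E := (ℂ ∙ ν)ᗮ.subtypeL ∘L ContinuousLinearMap.snd ℂ ℂ _ +
    (ContinuousLinearMap.fst ℂ ℂ _ - a ∘L (ℂ ∙ ν)ᗮ.subtypeL ∘L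
      ContinuousLinearMap.snd ℂ ℂ _).smulRight ((a ν)⁻¹ • ν)
  have hf : ∀ w, f w = w.2 + (w.1 - a w.2) • (a ν)⁻¹ • ν := fun w => rfl
  refine ⟨ContinuousLinearEquiv.equivOfInverse
    (a.prod ((ℂ ∙ ν)ᗮ.orthogonalProjectionOnto)) f (fun h => ?_) (fun w => ?_), fun h => rfl⟩
  · rw [hf]
    simp only [ContinuousLinearMap.prod_apply, coe_orthogonalProjectionOnto_span_singleton hν,
      map_sub, map_smul, smul_eq_mul, sub_sub_cancel, smul_smul, mul_inv_cancel_right₀ ha]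
    abel
  · have h1 : (ℂ ∙ ν)ᗮ.orthogonalProjectionOnto ν = 0 :=
      Submodule.orthogonalProjectionOnto_orthogonalComplement_singleton_eq_zero ν
    have h2 : (ℂ ∙ ν)ᗮ.orthogonalProjectionOnto (w.2 : E) = w.2 := by simp
    apply Prod.ext
    · change a (f w) = w.1
      rw [hf, map_add, map_smul, map_smul, smul_eq_mul, smul_eq_mul, inv_mul_cancel₀ ha]
      ring
    · change (ℂ ∙ ν)ᗮ.orthogonalProjectionOnto (f w) = w.2
      rw [hf, map_add, map_smul, map_smul, h1, h2]
      simp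

theorem norm_inner_le_of_near {ν : E} (hν : ‖ν‖ = 1) {a : E →L[ℂ] ℂ} {l θ : ℝ} (hl : 0 < l)
    (hθ : 0 < θ) (hθl : θ ≤ l / 2) (h : E) (ha : ‖a h + l * inner ℂ ν h‖ ≤ θ * ‖h‖) :
    ‖inner ℂ ν h‖ ≤ 2 / l * (‖a h‖ + θ * ‖(ℂ ∙ ν)ᗮ.orthogonalProjectionOnto h‖) := by
  have h1 := norm_sq_eq_norm_inner_sq_add hν h
  set x := ‖(ℂ ∙ ν)ᗮ.orthogonalProjectionOnto h‖ with hx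
  set S := ‖inner ℂ ν h‖ with hS
  have hx0 : 0 ≤ x := norm_nonneg _
  have hS0 : 0 ≤ S := norm_nonneg _
  have h2 : ‖h‖ ≤ x + S := abs_le_of_sq_le_sq' (by nlinarith) (by positivity) |>.2
  have h3 : l * S ≤ ‖a h‖ + θ * ‖h‖ := by
    have h4 := norm_sub_le (a h + l * inner ℂ ν h) (a h)
    rw [add_sub_cancel_left, norm_mul, Complex.norm_real, Real.norm_of_nonneg hl.le] at h4
    linarith
  rw [div_mul_eq_mul_div, le_div_iff₀ hl]
  nlinarith

/-- The Taylor estimate in the coordinates adapted to a nearby boundary point. -/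
theorem abs_sub_le_of_taylor {ν : E} (hν : ‖ν‖ = 1) {a : E →L[ℂ] ℂ} {A : E →L[ℝ] E →L[ℝ] ℝ}
    {l θ s : ℝ} (hl : 0 < l) (hθ : 0 < θ) (hθ1 : θ ≤ 1) (hθl : θ ≤ l / 2) (h : E) (hh : ‖h‖ ≤ θ)
    (ha : ‖a h + l * inner ℂ ν h‖ ≤ θ * ‖h‖) (hs : |s - A h h / 2| ≤ θ * ‖h‖ ^ 2) :
    |s - A ((ℂ ∙ ν)ᗮ.orthogonalProjectionOnto h) ((ℂ ∙ ν)ᗮ.orthogonalProjectionOnto h) / 2| ≤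
      θ * (1 + (‖A‖ + 1) * (4 / l)) *
        (‖(ℂ ∙ ν)ᗮ.orthogonalProjectionOnto h‖ ^ 2 + ‖a h‖) := by
  have h1 := norm_sq_eq_norm_inner_sq_add hν h
  have h2 := norm_inner_le_of_near hν hl hθ hθl h ha
  have h3 := coe_orthogonalProjectionOnto_span_singleton hν h
  set z := (ℂ ∙ ν)ᗮ.orthogonalProjectionOnto h with hz
  have hx0 : 0 ≤ ‖z‖ := norm_nonneg _
  set S := ‖inner ℂ ν h‖ with hS
  have hS0 : 0 ≤ S := norm_nonneg _
  set U := ‖a h‖ with hU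
  have hU0 : 0 ≤ U := norm_nonneg _
  have hn : ‖h‖ ≤ ‖z‖ + S := abs_le_of_sq_le_sq' (by nlinarith) (by positivity) |>.2
  have hzn : ‖z‖ ≤ ‖h‖ := abs_le_of_sq_le_sq' (by nlinarith) (norm_nonneg h) |>.2
  have hSn : S ≤ ‖h‖ := abs_le_of_sq_le_sq' (by nlinarith) (norm_nonneg h) |>.2
  have hθK : θ * (2 / l) ≤ 1 := by
    rw [mul_div_assoc', div_le_one hl]; linarith
  have hK0 : 0 < 2 / l := by positivity
  have h4 : S * ‖z‖ ≤ U + ‖z‖ ^ 2 := by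
    calc S * ‖z‖ ≤ 2 / l * (U + θ * ‖z‖) * ‖z‖ := by gcongr
      _ = U * ((2 / l) * ‖z‖) + θ * (2 / l) * ‖z‖ ^ 2 := by ring
      _ ≤ U * ((2 / l) * θ) + 1 * ‖z‖ ^ 2 := by gcongr; exact hzn.trans hh
      _ ≤ U * 1 + 1 * ‖z‖ ^ 2 := by gcongr; rwa [mul_comm]
      _ = U + ‖z‖ ^ 2 := by ring
  have h5 : S * ‖h‖ ≤ 4 / l * θ * (U + ‖z‖ ^ 2) := by
    calc S * ‖h‖ ≤ 2 / l * (U + θ * ‖z‖) * ‖h‖ := by gcongr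
      _ = 2 / l * (U * ‖h‖ + θ * (‖z‖ * ‖h‖)) := by ring
      _ ≤ 2 / l * (U * θ + θ * (‖z‖ * (‖z‖ + S))) := by gcongr
      _ ≤ 2 / l * (U * θ + θ * (‖z‖ ^ 2 + (U + ‖z‖ ^ 2))) := by gcongr; linarith
      _ = 4 / l * θ * (U + ‖z‖ ^ 2) := by ring
  have h6 : A h h - A z z = A h ((inner ℂ ν h) • ν) + A ((inner ℂ ν h) • ν) z := by
    rw [h3]
    simp only [map_sub, sub_apply]
    ring
  have h7 : |A h ((inner ℂ ν h) • ν)| ≤ ‖A‖ * (S * ‖h‖) := by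
    refine (A.le_opNorm₂ h ((inner ℂ ν h) • ν)).trans_eq ?_
    rw [norm_smul, hν]; ring
  have h8 : |A ((inner ℂ ν h) • ν) z| ≤ ‖A‖ * (S * ‖h‖) := by
    refine (A.le_opNorm₂ ((inner ℂ ν h) • ν) z).trans ?_
    rw [norm_smul, hν, mul_one, mul_assoc, Submodule.norm_coe]
    gcongr
  have h9 : ‖h‖ ^ 2 ≤ ‖z‖ ^ 2 + S * ‖h‖ := by nlinarith
  have h10 : |A h h / 2 - A z z / 2| ≤ ‖A‖ * (S * ‖h‖) := by
    rw [← sub_div, h6, abs_div, abs_two]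
    have := abs_add_le (A h ((inner ℂ ν h) • ν)) (A ((inner ℂ ν h) • ν) z)
    linarith
  calc |s - A z z / 2| ≤ |s - A h h / 2| + |A h h / 2 - A z z / 2| := abs_sub_le _ _ _
    _ ≤ θ * (‖z‖ ^ 2 + S * ‖h‖) + ‖A‖ * (S * ‖h‖) := by
      gcongr
      exact hs.trans (by gcongr)
    _ ≤ θ * ‖z‖ ^ 2 + (‖A‖ + 1) * (4 / l * θ * (U + ‖z‖ ^ 2)) := by
      have h11 : (‖A‖ + θ) * (S * ‖h‖) ≤ (‖A‖ + 1) * (4 / l * θ * (U + ‖z‖ ^ 2)) := by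
        gcongr
      linarith
    _ ≤ θ * (‖z‖ ^ 2 + U) + (‖A‖ + 1) * (4 / l * θ * (U + ‖z‖ ^ 2)) := by
      gcongr; linarith
    _ = _ := by ring

end Geometry

/-- A defining function vanishes on the boundary. -/
theorem eq_zero_of_mem_frontier {X : Type*} [TopologicalSpace X] {Ω U : Set X} (hΩ : IsOpen Ω)
    (hU : IsOpen U) {ρ : X → ℝ} (hρ : ContinuousOn ρ U) (hdef : ∀ x ∈ U, x ∈ Ω ↔ ρ x < 0)
    {x : X} (hxU : x ∈ U) (hx : x ∈ frontier Ω) : ρ x = 0 := by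
  rw [hΩ.frontier_eq] at hx
  refine le_antisymm ?_ (not_lt.1 fun h => hx.2 ((hdef x hxU).2 h))
  by_contra! h
  obtain ⟨y, ⟨hy, hyU⟩, hyΩ⟩ := mem_closure_iff_nhds.1 hx.1 _
    (((hρ.continuousAt (hU.mem_nhds hxU)).eventually_const_lt h).and (hU.mem_nhds hxU))
  exact lt_asymm hy ((hdef y hyU).1 hyΩ)

/-- A segment leaving an open set meets its boundary. -/
theorem exists_add_smul_mem_frontier {E : Type*} [NormedAddCommGroup E] [NormedSpace ℝ E]
    {Ω : Set E} (hΩ : IsOpen Ω) {q v : E} (hq : q ∈ Ω) {s : ℝ} (hs : 0 ≤ s)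
    (hqs : q + s • v ∉ Ω) : ∃ t, 0 < t ∧ t ≤ s ∧ q + t • v ∈ frontier Ω := by
  have hcont : Continuous fun t : ℝ => q + t • v := by fun_prop
  have hcomp : IsCompact (Icc 0 s ∩ (fun t : ℝ => q + t • v) ⁻¹' Ωᶜ) :=
    isCompact_Icc.inter_right (hΩ.isClosed_compl.preimage hcont)
  obtain ⟨t, ⟨ht, htΩ⟩, hleast⟩ := hcomp.exists_isLeast ⟨s, ⟨hs, le_rfl⟩, hqs⟩
  have ht0 : 0 < t := lt_of_le_of_ne ht.1 fun h => htΩ (by simpa [← h] using hq)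
  refine ⟨t, ht0, ht.2, ?_⟩
  rw [hΩ.frontier_eq]
  refine ⟨mem_closure_of_tendsto (f := fun t : ℝ => q + t • v) (b := nhdsWithin t (Iio t))
    (hcont.tendsto t |>.mono_left nhdsWithin_le_nhds) ?_, htΩ⟩
  filter_upwards [Ioo_mem_nhdsLT ht0] with u hu
  by_contra h
  exact (hleast ⟨⟨hu.1.le, (hu.2.trans_le ht.2).le⟩, h⟩).not_gt hu.2

theorem norm_extendRCLike_add_inner_le {E : Type*} [NormedAddCommGroup E] [InnerProductSpace ℂ E]
    {ν : E} {d d₀ : E →L[ℝ] ℝ} {l θ : ℝ} (hd₀ : ∀ h, d₀ h = l * reInner ν h)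
    (hd : ‖d - d₀‖ ≤ θ) (h : E) :
    ‖StrongDual.extendRCLike (𝕜 := ℂ) (-d) h + l * inner ℂ ν h‖ ≤ θ * ‖h‖ := by
  have h1 : StrongDual.extendRCLike (𝕜 := ℂ) (-d) h + l * inner ℂ ν h =
      StrongDual.extendRCLike (𝕜 := ℂ) (-(d - d₀)) h := by
    apply Complex.ext
    · simp [StrongDual.extendRCLike_apply, hd₀, reInner_apply]
      ring
    · simp [StrongDual.extendRCLike_apply, hd₀, reInner_apply]
  rw [h1]
  refine (ContinuousLinearMap.le_opNorm _ h).trans ?_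
  gcongr
  rw [StrongDual.norm_extendRCLike, norm_neg]
  exact hd

theorem exists_squeezing_map_of_taylor {E : Type*} [NormedAddCommGroup E] [InnerProductSpace ℂ E]
    [FiniteDimensional ℂ E] {ν : E} (hν : ‖ν‖ = 1) {d : E → E →L[ℝ] ℝ} {A : E →L[ℝ] E →L[ℝ] ℝ}
    {ρ : E → ℝ} {p : E} {l : ℝ} (hl : 0 < l) (hsymm : ∀ v w, A v w = A w v)
    (hdp : ∀ h, d p h = l * reInner ν h)
    (hT : ∀ η > 0, ∃ r > 0, ∀ x ∈ ball p r, ‖d x - d p‖ ≤ η ∧ ∀ h, ‖h‖ < r →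
      |ρ (x + h) - ρ x - d x h - A h h / 2| ≤ η * ‖h‖ ^ 2)
    {κ : ℝ} (hκ : 0 < κ) (hA : ∀ v, reInner ν v = 0 → κ * ‖v‖ ^ 2 ≤ A v v)
    {Ω : Set E} {r₀ : ℝ} (hr₀ : 0 < r₀) (hdef : ∀ x ∈ ball p r₀, x ∈ Ω ↔ ρ x < 0)
    {μ r₁ : ℝ} (hμ : 0 < μ) (hr₁ : 0 < r₁)
    (hglob : ∀ x ∈ ball p r₁, ρ x = 0 → ∀ h, x + h ∈ Ω → μ * ‖h‖ ^ 2 ≤ -d x h)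
    {ε : ℝ} (hε : 0 < ε) (hε2 : ε < 1 / 2) :
    ∃ r > 0, ∀ x ∈ ball p r, ρ x = 0 → x ∉ Ω → ∀ t, 0 < t → t < r → x - t • ν ∈ Ω →
      ∃ G : E → E, DifferentiableOn ℂ G Ω ∧ InjOn G Ω ∧ G (x - t • ν) = 0 ∧
        ball 0 (1 - ε) ⊆ G '' Ω ∧ G '' Ω ⊆ ball 0 (1 + ε) := by
  let i : (ℂ ∙ ν)ᗮ →L[ℝ] E := (ℂ ∙ ν)ᗮ.subtypeL.restrictScalars ℝ
  let B := A.bilinearComp i i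
  have hB : ∀ v w, B v w = A v w := fun v w => rfl
  have hBsymm : ∀ v w, B v w = B w v := fun v w => hsymm _ _
  have hBpos : ∀ v, κ * ‖v‖ ^ 2 ≤ B v v := fun v => by
    refine hA v ?_
    rw [reInner_apply, Submodule.mem_orthogonal_singleton_iff_inner_right.1 v.2, Complex.zero_re]
  obtain ⟨M, hM⟩ := exists_norm_sq_eq_hermitianPart hBsymm hκ hBpos
  obtain ⟨Φ₀, hΦ₀⟩ := exists_coordinates hν (a := innerSL ℂ ν) (by simp [hν, inner_self_eq_norm_sq_to_K])
  let L : (ℂ × (ℂ ∙ ν)ᗮ) ≃L[ℂ] E := ((ContinuousLinearEquiv.refl ℂ ℂ).prodCongr M).trans Φ₀.symm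
  have hL : ∀ w, ‖L w‖ ^ 2 = ‖w.1‖ ^ 2 + hermitianPart B w.2 := fun w => by
    have h1 : Φ₀ (L w) = (w.1, M w.2) := Φ₀.apply_symm_apply _
    rw [hΦ₀, Prod.mk.injEq] at h1
    rw [norm_sq_eq_norm_inner_sq_add hν, h1.2, hM, ← h1.1]
    rfl
  have hκ' : 0 < min μ (κ / 2) := by positivity
  obtain ⟨η, hη, hcore⟩ := exists_squeezing_map_of_model (differentiable_quadraticPart hBsymm)
    (quadraticPart_smul hBsymm) hκ' (norm_nonneg B) (norm_quadraticPart_le B)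
    (hermitianPart_smul hBsymm)
    (fun v => (by gcongr; exact min_le_right _ _ : _ ≤ κ / 2 * ‖v‖ ^ 2).trans
      (le_hermitianPart hBpos v)) (hermitianPart_le B) hL hε hε2
  set N := 1 + (‖A‖ + 1) * (4 / l) with hN
  have hN0 : 0 < N := by positivity
  set θ := min (min 1 (l / 2)) (min (η / N) (η * l)) with hθ
  have hθ0 : 0 < θ := by positivity
  have hθ1 : θ ≤ 1 := (min_le_left _ _).trans (min_le_left _ _)
  have hθl : θ ≤ l / 2 := (min_le_left _ _).trans (min_le_right _ _)
  have hθN : θ * N ≤ η := (le_div_iff₀ hN0).1 ((min_le_right _ _).trans (min_le_left _ _))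
  have hθη : θ ≤ η * l := (min_le_right _ _).trans (min_le_right _ _)
  obtain ⟨r₂, hr₂, hT⟩ := hT θ hθ0
  set r₃ := min (min r₂ θ) (r₀ / 2) with hr₃
  have hr₃0 : 0 < r₃ := by positivity
  obtain ⟨δ₀, hδ₀, hcore⟩ := hcore (min (μ * r₃ ^ 2) (r₃ / (2 * (1 + 2 / l)))) (by positivity)
  refine ⟨min (min r₁ r₂) (min (r₀ / 2) (δ₀ / l)), by positivity,
    fun x hx hρx hxΩ t ht htr hq => ?_⟩
  have hxr₁ : x ∈ ball p r₁ := ball_subset_ball ((min_le_left _ _).trans (min_le_left _ _)) hx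
  have hxr₂ : x ∈ ball p r₂ := ball_subset_ball ((min_le_left _ _).trans (min_le_right _ _)) hx
  have hxr₀ : x ∈ ball p (r₀ / 2) :=
    ball_subset_ball ((min_le_right _ _).trans (min_le_left _ _)) hx
  have htδ : l * t < δ₀ := by
    rw [← lt_div_iff₀' hl]
    exact htr.trans_le ((min_le_right _ _).trans (min_le_right _ _))
  let a : E →L[ℂ] ℂ := StrongDual.extendRCLike (𝕜 := ℂ) (-d x)
  have ha : ∀ h, ‖a h + l * inner ℂ ν h‖ ≤ θ * ‖h‖ := fun h =>
    norm_extendRCLike_add_inner_le hdp (hT x hxr₂).1 h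
  have hare : ∀ h, (a h).re = -d x h := fun h =>
    StrongDual.re_extendRCLike_apply (𝕜 := ℂ) (-d x) h
  have haν : ‖a ν + l‖ ≤ θ := by
    have := ha ν
    rwa [inner_self_eq_norm_sq_to_K, hν, RCLike.ofReal_one, one_pow, mul_one, mul_one] at this
  have haν0 : a ν ≠ 0 := fun h => by
    rw [h, zero_add, Complex.norm_real, Real.norm_of_nonneg hl.le] at haν
    linarith
  obtain ⟨Φ, hΦ⟩ := exists_coordinates hν haν0
  have hΦsymm : ∀ w, a (Φ.symm w) = w.1 ∧ (ℂ ∙ ν)ᗮ.orthogonalProjectionOnto (Φ.symm w) = w.2 :=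
    fun w => Prod.mk.inj ((hΦ (Φ.symm w)).symm.trans (Φ.apply_symm_apply w))
  have hball : ∀ h, ‖h‖ < r₃ → x + h ∈ ball p r₀ := fun h hh => by
    have h1 := norm_add_le (x - p) h
    have h2 := mem_ball_iff_norm.1 hxr₀
    have h3 : r₃ ≤ r₀ / 2 := min_le_right _ _
    rw [mem_ball_iff_norm, add_sub_right_comm]
    linarith
  have hmodel : ∀ w, ‖Φ.symm w‖ < r₃ → |ρ (x + Φ.symm w) + w.1.re -
      (hermitianPart B w.2 + (quadraticPart B w.2).re)| ≤ η * (‖w.2‖ ^ 2 + ‖w.1‖) := by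
    intro w hw
    have hw2 : ‖Φ.symm w‖ < min r₂ θ := hw.trans_le (min_le_left _ _)
    have h1 := (hT x hxr₂).2 _ (hw2.trans_le (min_le_left _ _))
    rw [hρx, sub_zero] at h1
    have h2 := abs_sub_le_of_taylor hν hl hθ0 hθ1 hθl _ (hw2.trans_le (min_le_right _ _)).le
      (ha _) h1
    rw [(hΦsymm w).1, (hΦsymm w).2, ← hN] at h2
    rw [hermitianPart_add_re_quadraticPart, hB, ← (hΦsymm w).1, hare, ← sub_eq_add_neg,
      (hΦsymm w).1]
    exact h2.trans (by gcongr)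
  let D : Set (ℂ × (ℂ ∙ ν)ᗮ) := {w | x + Φ.symm w ∈ Ω}
  have hΦq : Φ (-(t • ν)) = (a (-(t • ν)), 0) := by
    rw [hΦ]
    congr 1
    rw [← Complex.coe_smul, map_neg, map_smul,
      Submodule.orthogonalProjectionOnto_orthogonalComplement_singleton_eq_zero, smul_zero, neg_zero]
  have hDglob : ∀ w ∈ D, μ * ‖Φ.symm w‖ ^ 2 ≤ w.1.re := fun w hw => by
    have := hglob x hxr₁ hρx _ hw
    rwa [← hare, (hΦsymm w).1] at this
  obtain ⟨G, hGd, hGi, hG0, hG1, hG2⟩ : ∃ G : ℂ × (ℂ ∙ ν)ᗮ → E, DifferentiableOn ℂ G D ∧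
      InjOn G D ∧ G (a (-(t • ν)), 0) = 0 ∧ ball 0 (1 - ε) ⊆ G '' D ∧
      G '' D ⊆ ball 0 (1 + ε) := by
    refine hcore (l * t) (by positivity) htδ (a (-(t • ν))) ?_ D ?_ ?_ ?_ ?_
    · have h1 := ha (-(t • ν))
      rw [norm_neg, norm_smul, hν, Real.norm_of_nonneg ht.le, mul_one] at h1
      have h2 : inner ℂ ν (-(t • ν)) = -(t : ℂ) := by
        rw [inner_neg_right, ← Complex.coe_smul, inner_smul_right, inner_self_eq_norm_sq_to_K, hν,
          RCLike.ofReal_one, one_pow, mul_one]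
      rw [h2, mul_neg, ← sub_eq_add_neg] at h1
      rw [Complex.ofReal_mul, ← mul_assoc]
      exact h1.trans (by gcongr)
    · change x + Φ.symm _ ∈ Ω
      rw [← hΦq, Φ.symm_apply_apply, ← sub_eq_add_neg]
      exact hq
    · intro w hw
      have h1 := hDglob w hw
      have h0 : Φ.symm w ≠ 0 := fun h => hxΩ (by
        have hw : x + Φ.symm w ∈ Ω := hw
        rwa [h, add_zero] at hw)
      have h2 : 0 < ‖Φ.symm w‖ := norm_pos_iff.2 h0
      have h3 : ‖w.2‖ ≤ ‖Φ.symm w‖ := by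
        have := norm_sq_eq_norm_inner_sq_add hν (Φ.symm w)
        rw [(hΦsymm w).2] at this
        exact abs_le_of_sq_le_sq' (by nlinarith) h2.le |>.2
      refine ⟨lt_of_lt_of_le (by positivity) h1, le_trans ?_ h1⟩
      gcongr
      exact min_le_left _ _
    · intro w hw hwm
      have h1 := hDglob w hw
      have h2 : ‖Φ.symm w‖ < r₃ := by
        have h3 : μ * ‖Φ.symm w‖ ^ 2 < μ * r₃ ^ 2 :=
          h1.trans_lt ((Complex.re_le_norm _).trans_lt (hwm.trans_le (min_le_left _ _)))
        exact lt_of_pow_lt_pow_left₀ 2 hr₃0.le (lt_of_mul_lt_mul_left h3 hμ.le)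
      have h3 := (abs_le.1 (hmodel w h2)).1
      have h4 := (hdef _ (hball _ h2)).1 hw
      linarith
    · intro w hw1 hw2 hw
      have h2 : ‖Φ.symm w‖ < r₃ := by
        have h3 := norm_inner_le_of_near hν hl hθ0 hθl _ (ha (Φ.symm w))
        have h4 := norm_sq_eq_norm_inner_sq_add hν (Φ.symm w)
        rw [(hΦsymm w).2] at h3 h4
        rw [(hΦsymm w).1] at h3
        set S := ‖inner ℂ ν (Φ.symm w)‖
        have hS0 : 0 ≤ S := norm_nonneg _
        have h5 : ‖Φ.symm w‖ ≤ ‖w.2‖ + S :=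
          abs_le_of_sq_le_sq' (by nlinarith [norm_nonneg w.2]) (by positivity) |>.2
        have h6 : 2 / l * (‖w.1‖ + θ * ‖w.2‖) ≤ 2 / l * (‖w.1‖ + 1 * ‖w.2‖) := by gcongr
        have h7 := hw1.trans_le (min_le_right _ _)
        have h8 := hw2.trans_le (min_le_right _ _)
        have h9 : 2 * (1 + 2 / l) * (r₃ / (2 * (1 + 2 / l))) = r₃ := by field_simp
        have h10 : (1 + 2 / l) * (‖w.1‖ + ‖w.2‖) <
            (1 + 2 / l) * (r₃ / (2 * (1 + 2 / l)) + r₃ / (2 * (1 + 2 / l))) := by gcongr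
        linarith [norm_nonneg w.1]
      have h3 := (abs_le.1 (hmodel w h2)).2
      exact (hdef _ (hball _ h2)).2 (by linarith)
  have himage : (fun y => G (Φ (y - x))) '' Ω = G '' D := by
    ext z
    constructor
    · rintro ⟨y, hy, rfl⟩
      exact ⟨_, by simpa [D] using hy, rfl⟩
    · rintro ⟨w, hw, rfl⟩
      exact ⟨_, hw, by simp⟩
  have hmaps : MapsTo (fun y => Φ (y - x)) Ω D := fun y hy => by simpa [D] using hy
  refine ⟨fun y => G (Φ (y - x)), ?_, ?_, ?_, ?_, ?_⟩
  · exact hGd.comp (by fun_prop) hmaps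
  · intro y hy z hz h
    simpa using hGi (hmaps hy) (hmaps hz) h
  · simpa [hΦq] using hG0
  · rwa [himage]
  · rwa [himage]

theorem exists_squeezing_map {E : Type*} [NormedAddCommGroup E] [InnerProductSpace ℂ E]
    [FiniteDimensional ℂ E] {Ω : Set E} (hΩ : IsOpen Ω) {p : E} (hp : p ∈ frontier Ω)
    {r₀ : ℝ} (hr₀ : 0 < r₀) {ρ : E → ℝ} (hρ : ContDiffOn ℝ 2 ρ (ball p r₀))
    (hgrad : fderiv ℝ ρ p ≠ 0) (hdef : ∀ x ∈ ball p r₀, x ∈ Ω ↔ ρ x < 0)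
    {c : E} {R : ℝ} (hR : 0 < R) (hΩball : Ω ⊆ ball c R) (hpc : ‖p - c‖ = R)
    {ε : ℝ} (hε : 0 < ε) (hε2 : ε < 1 / 2) :
    ∃ r > (0 : ℝ), ∀ q ∈ Ω ∩ ball p r, ∃ G : E → E,
      DifferentiableOn ℂ G Ω ∧ InjOn G Ω ∧ G q = 0 ∧
      ball 0 (1 - ε) ⊆ G '' Ω ∧ G '' Ω ⊆ ball 0 (1 + ε) := by
  have hzero : ∀ x ∈ ball p r₀, x ∈ frontier Ω → ρ x = 0 := fun x hx hxf =>
    eq_zero_of_mem_frontier hΩ isOpen_ball hρ.continuousOn hdef hx hxf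
  have hp0 : ρ p = 0 := hzero p (mem_ball_self hr₀) hp
  obtain ⟨ν, hν, hpν⟩ : ∃ ν : E, ‖ν‖ = 1 ∧ p - c = R • ν :=
    ⟨R⁻¹ • (p - c), by rw [norm_smul, hpc, Real.norm_of_nonneg (by positivity),
      inv_mul_cancel₀ hR.ne'], by rw [smul_smul, mul_inv_cancel₀ hR.ne', one_smul]⟩
  have hnorm : ∀ h, ‖p + h - c‖ ^ 2 = R ^ 2 + (‖h‖ ^ 2 + 2 * R * reInner ν h) := fun h => by
    rw [add_sub_right_comm, hpν, @norm_add_sq ℂ, reInner_apply, norm_smul, hν,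
      Real.norm_of_nonneg hR.le, inner_smul_left_eq_smul]
    simp
    ring
  have hball : ∀ h, p + h ∈ Ω → ‖h‖ ^ 2 + 2 * R * reInner ν h < 0 := fun h hh => by
    have h1 := mem_ball_iff_norm.1 (hΩball hh)
    have h2 := pow_lt_pow_left₀ h1 (norm_nonneg _) two_ne_zero
    rw [hnorm] at h2
    linarith
  have hCD : ContDiffAt ℝ 2 ρ p := hρ.contDiffAt (ball_mem_nhds p hr₀)
  set A := fderiv ℝ (fderiv ℝ ρ) p with hA
  have hsymm : ∀ v w, A v w = A w v := fun v w => (hCD.isSymmSndFDerivAt (by simp)) v w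
  have hT : ∀ η > 0, ∃ r > 0, ∀ x ∈ ball p r, ‖fderiv ℝ ρ x - fderiv ℝ ρ p‖ ≤ η ∧
      ∀ h, ‖h‖ < r → |ρ (x + h) - ρ x - fderiv ℝ ρ x h - A h h / 2| ≤ η * ‖h‖ ^ 2 :=
    fun η hη => exists_taylor_estimate hCD hη
  have hTp : ∀ η > 0, ∃ r > 0, ∀ h, ‖h‖ < r →
      |ρ (p + h) - fderiv ℝ ρ p h - A h h / 2| ≤ η * ‖h‖ ^ 2 := fun η hη => by
    obtain ⟨r, hr, h⟩ := hT η hη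
    refine ⟨r, hr, ?_⟩
    have := (h p (mem_ball_self hr)).2
    simpa only [hp0, sub_zero] using this
  have hball' : ∀ h, ‖h‖ < r₀ → ρ (p + h) < 0 → ‖h‖ ^ 2 + 2 * R * reInner ν h < 0 :=
    fun h hh hρh => hball h ((hdef _ (by simpa [mem_ball_iff_norm] using hh)).2 hρh)
  obtain ⟨l, hl, hdl⟩ := exists_eq_mul_reInner hR hgrad hTp hr₀ hball'
  have hTl : ∀ η > 0, ∃ r > 0, ∀ h, ‖h‖ < r →
      |ρ (p + h) - l * reInner ν h - A h h / 2| ≤ η * ‖h‖ ^ 2 := by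
    simpa only [hdl] using hTp
  have hpos : ∀ v, reInner ν v = 0 → l / R * ‖v‖ ^ 2 ≤ A v v := fun v hv =>
    le_hessian_of_reInner_eq_zero hν hR hl hTl hr₀ hball' hv
  obtain ⟨μ, hμ, r₁, hr₁, hglob⟩ := exists_forall_mul_norm_sq_le hν hR hl hdl hT
    (by positivity) hpos hr₀ (fun x hx hxr => (hdef x hxr).1 hx) hball
  obtain ⟨r, hr, H⟩ := exists_squeezing_map_of_taylor hν hl hsymm hdl hT (by positivity) hpos hr₀
    hdef hμ hr₁ hglob hε hε2
  refine ⟨min r r₀ / 2, by positivity, fun q ⟨hq, hqp⟩ => ?_⟩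
  rw [mem_ball_iff_norm] at hqp
  have hqs : q + ‖q - p‖ • ν ∉ Ω := fun h => by
    rw [show q + ‖q - p‖ • ν = p + ((q - p) + ‖q - p‖ • ν) by abel] at h
    have h1 := hball _ h
    rw [map_add, map_smul, reInner_self hν, smul_eq_mul, mul_one] at h1
    have h2 := neg_le_of_abs_le (abs_reInner_le hν (q - p))
    have h3 : 0 ≤ 2 * R * (reInner ν (q - p) + ‖q - p‖) :=
      mul_nonneg (by positivity) (by linarith)
    nlinarith [sq_nonneg ‖q - p + ‖q - p‖ • ν‖]
  obtain ⟨t, ht, hts, hx⟩ := exists_add_smul_mem_frontier hΩ hq (norm_nonneg _) hqs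
  have hxp : ‖q + t • ν - p‖ < min r r₀ := by
    have h1 := norm_add_le (q - p) (t • ν)
    rw [norm_smul, hν, Real.norm_of_nonneg ht.le, ← add_sub_right_comm] at h1
    linarith
  have hxr := mem_ball_iff_norm.2 (hxp.trans_le (min_le_left _ _))
  have hxr₀ := mem_ball_iff_norm.2 (hxp.trans_le (min_le_right _ _))
  have h := H _ hxr (hzero _ hxr₀ hx) (hΩ.frontier_eq ▸ hx).2 t ht
    (by have := min_le_left r r₀; linarith)
  rw [add_sub_cancel_right] at h
  exact h hq

/-- If `Ω ⊆ ℂⁿ` is a bounded domain and `p ∈ ∂Ω` is a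
spherically-extreme boundary point, then for every `0 < ε < 1/2` there is `r > 0`
such that every `q ∈ Ω ∩ B(p, r)` admits an injective holomorphic `G : Ω → ℂⁿ` with
`G q = 0` and `B(0, 1-ε) ⊆ G(Ω) ⊆ B(0, 1+ε)`. -/
theorem squeezing_map_near_spherically_extreme (n : ℕ)
    (Ω : Set (EuclideanSpace ℂ (Fin n)))
    (hopen : IsOpen Ω) (hconn : IsConnected Ω) (hbdd : Bornology.IsBounded Ω)
    (p : EuclideanSpace ℂ (Fin n)) (hp : p ∈ frontier Ω)
    (r₀ : ℝ) (hr₀ : 0 < r₀)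
    (ρ : EuclideanSpace ℂ (Fin n) → ℝ)
    (hρ : ContDiffOn ℝ 2 ρ (ball p r₀))
    (hgrad : ∀ x ∈ ball p r₀, fderiv ℝ ρ x ≠ 0)
    (hdef : Ω ∩ ball p r₀ = {x | ρ x < 0} ∩ ball p r₀)
    (c : EuclideanSpace ℂ (Fin n)) (R : ℝ) (hR : 0 < R)
    (hΩball : Ω ⊆ ball c R) (hpc : ‖p - c‖ = R) :
    ∀ ε : ℝ, 0 < ε → ε < 1 / 2 → ∃ r > (0 : ℝ), ∀ q ∈ Ω ∩ ball p r,
      ∃ G : EuclideanSpace ℂ (Fin n) → EuclideanSpace ℂ (Fin n),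
        DifferentiableOn ℂ G Ω ∧ InjOn G Ω ∧ G q = 0 ∧
        ball 0 (1 - ε) ⊆ G '' Ω ∧ G '' Ω ⊆ ball 0 (1 + ε) := by
  have hdef' : ∀ x ∈ ball p r₀, x ∈ Ω ↔ ρ x < 0 := fun x hx => by
    have h := Set.ext_iff.1 hdef x
    simpa only [mem_inter_iff, hx, and_true, mem_ofPred_eq] using h
  exact fun ε hε hε2 => exists_squeezing_map hopen hp hr₀ hρ (hgrad p (mem_ball_self hr₀)) hdef' hR
    hΩball hpc hε hε2
end

section
/- Let Ω ⊆ ℂⁿ be a bounded domain and p ∈ ∂Ω a spherically-extreme boundary point with ∂Ω of class C² on B(p, r₀). Then there exist positive constants r₂ < r₀ and R such that for every q ∈ Ω ∩ B(p, r₂) there exist b(q) ∈ ∂Ω and c(q) ∈ ℂⁿ satisfying: (i) ‖q − b(q)‖ < ‖q − z‖ for every z ∈ ∂Ω with z ≠ b(q) (b(q) is the unique closest boundary point to q), and (ii) ‖c(q) − b(q)‖ = R and Ω ⊆ B(c(q), R). -/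
open Metric Set

open Filter Topology in
/-- If `f < 0` forces `g ≤ 0` near a common zero of `f` and `g`, then the differential of `g` there
is a nonnegative multiple of the one of `f`. -/
theorem exists_fderiv_eq_smul_of_neg_imp_nonpos {V : Type*} [NormedAddCommGroup V]
    [NormedSpace ℝ V] {f g : V → ℝ} {f' g' : V →L[ℝ] ℝ} {x : V} (hf : HasFDerivAt f f' x)
    (hg : HasFDerivAt g g' x) (hfx : f x = 0) (hgx : g x = 0) (hf' : f' ≠ 0)
    (h : ∀ᶠ y in 𝓝 x, f y < 0 → g y ≤ 0) :
    ∃ t : ℝ, 0 ≤ t ∧ ∀ v, g' v = t * f' v := by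
  have line : ∀ v : V, HasDerivAt (fun t : ℝ => x + t • v) v 0 := fun v => by
    simpa using ((hasDerivAt_id (0 : ℝ)).smul_const v).const_add x
  have slope : ∀ {k : V → ℝ} {k' : V →L[ℝ] ℝ}, HasFDerivAt k k' x → k x = 0 → ∀ v,
      Tendsto (fun t : ℝ => t⁻¹ * k (x + t • v)) (𝓝[>] 0) (𝓝 (k' v)) := by
    intro k k' hk hkx v
    have hk0 : HasFDerivAt k k' (x + (0 : ℝ) • v) := by simpa using hk
    simpa [hkx] using (hk0.comp_hasDerivAt (0 : ℝ) (line v)).tendsto_slope_zero_right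
  have key : ∀ v, f' v < 0 → g' v ≤ 0 := by
    intro v hv
    refine le_of_tendsto (slope hg hgx v) ?_
    have hx : Tendsto (fun t : ℝ => x + t • v) (𝓝[>] 0) (𝓝 x) := by
      have := (line v).continuousAt.tendsto
      simp only [zero_smul, add_zero] at this
      exact this.mono_left nhdsWithin_le_nhds
    filter_upwards [(slope hf hfx v).eventually_lt_const hv, hx.eventually h,
      self_mem_nhdsWithin] with t ht h2 h0
    have h0 : 0 < t⁻¹ := inv_pos.2 h0
    exact mul_nonpos_of_nonneg_of_nonpos h0.le (h2 (by
      by_contra! hc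
      exact absurd ht (not_lt.2 (mul_nonneg h0.le hc))))
  obtain ⟨w, hw⟩ : ∃ w, f' w ≠ 0 := by
    by_contra! hc
    exact hf' (ContinuousLinearMap.ext hc)
  obtain ⟨u, hu⟩ : ∃ u, f' u = -1 := ⟨(-(f' w)⁻¹) • w, by simp [hw]⟩
  have ker : ∀ v, f' v = 0 → g' v = 0 := by
    intro v hv
    by_contra hgv
    have := key (u + ((1 - g' u) / g' v) • v) (by simp [hu, hv])
    simp [hgv] at this
    linarith
  refine ⟨-g' u, by linarith [key u (by simp [hu])], fun v => ?_⟩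
  have := ker (v + f' v • u) (by simp [hu])
  simp only [map_add, map_smul, smul_eq_mul] at this
  linarith

/-- Second-order Taylor lower bound on a convex set. -/
theorem Convex.add_fderiv_add_le {V : Type*} [NormedAddCommGroup V]
    [NormedSpace ℝ V] {s : Set V} (hs : Convex ℝ s) {f : V → ℝ} {f' : V → V →L[ℝ] ℝ}
    {f'' : V → V →L[ℝ] V →L[ℝ] ℝ} (hf : ∀ x ∈ s, HasFDerivAt f (f' x) x)
    (hf' : ∀ x ∈ s, HasFDerivAt f' (f'' x) x) {ε : ℝ}
    (hε : ∀ x ∈ s, ∀ v, ε * ‖v‖ ^ 2 ≤ f'' x v v) {x y : V} (hx : x ∈ s) (hy : y ∈ s) :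
    f x + f' x (y - x) + ε / 2 * ‖y - x‖ ^ 2 ≤ f y := by
  set v := y - x with hv
  have mem : ∀ t ∈ Icc (0 : ℝ) 1, x + t • v ∈ s := fun t ht => hs.add_smul_sub_mem hx hy ht
  have line : ∀ t : ℝ, HasDerivAt (fun t : ℝ => x + t • v) v t := fun t => by
    simpa using ((hasDerivAt_id t).smul_const v).const_add x
  have mono : ∀ k k' : ℝ → ℝ, (∀ t ∈ Icc (0 : ℝ) 1, HasDerivAt k (k' t) t) →
      (∀ t ∈ Icc (0 : ℝ) 1, 0 ≤ k' t) → ∀ t ∈ Icc (0 : ℝ) 1, k 0 ≤ k t := by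
    intro k k' hk hk' t ht
    refine monotoneOn_of_deriv_nonneg (convex_Icc 0 1)
      (fun t ht => (hk t ht).continuousAt.continuousWithinAt)
      (fun t ht => (hk t (interior_subset ht)).differentiableAt.differentiableWithinAt)
      (fun t ht => ?_) (by simp) ht ht.1
    rw [(hk t (interior_subset ht)).deriv]
    exact hk' t (interior_subset ht)
  have first : ∀ t ∈ Icc (0 : ℝ) 1, 0 ≤ f' (x + t • v) v - f' x v - ε * ‖v‖ ^ 2 * t := by
    intro t ht
    have hd : ∀ t ∈ Icc (0 : ℝ) 1, HasDerivAt (fun t => f' (x + t • v) v - f' x v - ε * ‖v‖ ^ 2 * t)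
        (f'' (x + t • v) v v - ε * ‖v‖ ^ 2) t := by
      intro t ht
      have h0 : HasDerivAt (fun t => f' (x + t • v)) (f'' (x + t • v) v) t :=
        (hf' _ (mem t ht)).comp_hasDerivAt t (line t)
      have h1 : HasDerivAt (fun t => f' (x + t • v) v) (f'' (x + t • v) v v) t := by
        simpa using h0.clm_apply (hasDerivAt_const t v)
      simpa using (h1.sub_const (f' x v)).fun_sub ((hasDerivAt_id t).const_mul (ε * ‖v‖ ^ 2))
    simpa using mono _ _ hd (fun t ht => sub_nonneg.2 (hε _ (mem t ht) v)) t ht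
  have hd : ∀ t ∈ Icc (0 : ℝ) 1,
      HasDerivAt (fun t => f (x + t • v) - f x - f' x v * t - ε * ‖v‖ ^ 2 / 2 * t ^ 2)
        (f' (x + t • v) v - f' x v - ε * ‖v‖ ^ 2 * t) t := by
    intro t ht
    have h1 : HasDerivAt (fun t => f (x + t • v)) (f' (x + t • v) v) t :=
      (hf _ (mem t ht)).comp_hasDerivAt t (line t)
    have h2 := ((h1.sub_const (f x)).sub ((hasDerivAt_id t).const_mul (f' x v))).sub
      ((hasDerivAt_pow 2 t).const_mul (ε * ‖v‖ ^ 2 / 2))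
    refine h2.congr_deriv ?_
    simp
    ring
  have := mono _ _ hd first 1 (by simp)
  have hxy : x + v = y := by simp [hv]
  simp only [one_smul, hxy, zero_smul, add_zero] at this
  linarith

/-- A quadratic form that is positive on the kernel of a linear form becomes positive definite
after adding a large multiple of the square of the linear form. -/
theorem exists_pos_le_add_mul_sq {V : Type*} [NormedAddCommGroup V]
    [NormedSpace ℝ V] [FiniteDimensional ℝ V] (B : V →L[ℝ] V →L[ℝ] ℝ) (l : V →L[ℝ] ℝ)
    (h : ∀ v, v ≠ 0 → l v = 0 → 0 < B v v) :
    ∃ K ε : ℝ, 0 ≤ K ∧ 0 < ε ∧ ∀ v, ε * ‖v‖ ^ 2 ≤ B v v + K * l v ^ 2 := by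
  have hcont : ∀ K : ℝ, Continuous fun v => B v v + K * l v ^ 2 := fun K => by fun_prop
  have hS := isCompact_sphere (0 : V) 1
  obtain ⟨K, hK⟩ := hS.elim_directed_cover
    (fun k : ℕ => {v | 0 < B v v + k * l v ^ 2}) (fun k => isOpen_lt continuous_const (hcont k))
    (by
      intro v hv
      have hv0 : v ≠ 0 := by rintro rfl; simp at hv
      rw [mem_iUnion]
      by_cases hl : l v = 0
      · exact ⟨0, by simpa using h v hv0 hl⟩
      · have hl2 : 0 < l v ^ 2 := by positivity
        obtain ⟨k, hk⟩ := exists_nat_gt (-(B v v) / l v ^ 2)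
        rw [div_lt_iff₀ hl2] at hk
        exact ⟨k, by rw [mem_ofPred_eq]; linarith⟩)
    (Monotone.directed_le (by
      intro i j hij v hv
      rw [mem_ofPred_eq] at hv ⊢
      refine lt_of_lt_of_le hv ?_
      gcongr))
  obtain ⟨ε, hε, hle⟩ := hS.exists_forall_le' (hcont K).continuousOn (a := 0) hK
  refine ⟨K, ε, by positivity, hε, fun v => ?_⟩
  rcases eq_or_ne v 0 with rfl | hv
  · simp
  have hn : 0 < ‖v‖ := norm_pos_iff.2 hv
  have := hle (‖v‖⁻¹ • v) (by simp [norm_smul, hn.ne'])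
  simp only [map_smul, smul_apply, smul_eq_mul] at this
  have h2 := mul_le_mul_of_nonneg_right this (sq_nonneg ‖v‖)
  refine h2.trans_eq ?_
  field_simp

open Filter Topology in
/-- The second-derivative necessary condition at a local minimum of a function of one variable. -/
theorem IsLocalMin.deriv_deriv_nonneg {f : ℝ → ℝ} {x : ℝ} (h : IsLocalMin f x)
    (hc : ContinuousAt f x) : 0 ≤ deriv (deriv f) x := by
  by_contra! hneg
  have hmax := isLocalMax_of_deriv_deriv_neg hneg h.deriv_eq_zero hc
  have heq : f =ᶠ[𝓝 x] fun _ => f x := by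
    filter_upwards [h, hmax] with y h1 h2 using le_antisymm h2 h1
  have := heq.deriv.deriv_eq
  simp at this
  exact hneg.ne this

open Filter Topology in
/-- The differential of `f` is a positive multiple of the outer normal of a sphere touching
`{f < 0}` from outside. -/
theorem exists_inner_eq_of_neg_imp_norm_lt {V : Type*} [NormedAddCommGroup V]
    [InnerProductSpace ℝ V] {f : V → ℝ} {f' : V →L[ℝ] ℝ} {p c : V} (hf : HasFDerivAt f f' p)
    (hfp : f p = 0) (hf' : f' ≠ 0) (hpc : p ≠ c)
    (h : ∀ᶠ y in 𝓝 p, f y < 0 → ‖y - c‖ < ‖p - c‖) :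
    ∃ t : ℝ, 0 < t ∧ ∀ v, inner ℝ (p - c) v = t * f' v := by
  have hg : HasFDerivAt (fun y => ‖y - c‖ ^ 2 - ‖p - c‖ ^ 2)
      (2 • (innerSL ℝ) (p - c) ∘SL ContinuousLinearMap.id ℝ V) p :=
    ((hasFDerivAt_id p).sub_const c).norm_sq.sub_const _
  obtain ⟨t, ht, hgt⟩ := exists_fderiv_eq_smul_of_neg_imp_nonpos hf hg hfp (by simp) hf'
    (h.mono fun y hy hfy => sub_nonpos.2 (by gcongr; exact (hy hfy).le))
  have hgt : ∀ v, inner ℝ (p - c) v = t / 2 * f' v := fun v => by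
    have := hgt v
    simp [← inner_sub_left] at this
    linarith
  refine ⟨t / 2, ?_, hgt⟩
  rcases ht.eq_or_lt with rfl | ht
  · have := hgt (p - c)
    simp [sub_eq_zero, hpc] at this
  · positivity

open Filter Topology in
/-- If a sphere touches `{f < 0}` from outside at a regular point, then the Hessian of `f` is
positive definite on the tangent space there. -/
theorem fderiv_fderiv_pos_of_neg_imp_norm_lt {V : Type*} [NormedAddCommGroup V]
    [InnerProductSpace ℝ V] {f : V → ℝ} {f' : V → V →L[ℝ] ℝ} {f'' : V →L[ℝ] V →L[ℝ] ℝ} {p c : V}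
    (hf : ∀ᶠ x in 𝓝 p, HasFDerivAt f (f' x) x) (hf' : HasFDerivAt f' f'' p)
    (hfp : f p = 0) (hf0 : f' p ≠ 0) (hpc : p ≠ c)
    (h : ∀ᶠ y in 𝓝 p, f y < 0 → ‖y - c‖ < ‖p - c‖) {v : V} (hv : v ≠ 0) (hfv : f' p v = 0) :
    0 < f'' v v := by
  obtain ⟨t, ht, hin⟩ := exists_inner_eq_of_neg_imp_norm_lt hf.self_of_nhds hfp hf0 hpc h
  have hr : 0 < ‖p - c‖ := norm_pos_iff.2 (sub_ne_zero.2 hpc)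
  have hvn : 0 < ‖v‖ := norm_pos_iff.2 hv
  have hout : 0 < f' p (p - c) := by
    have := hin (p - c)
    rw [real_inner_self_eq_norm_sq] at this
    exact pos_of_mul_pos_right (this ▸ by positivity) ht.le
  set a := ‖v‖ ^ 2 / (2 * ‖p - c‖ ^ 2) with ha
  have ha0 : 0 < a := by positivity
  set x : ℝ → V := fun s => p + s • v - (a * s ^ 2) • (p - c) with hx
  have hx' : ∀ s, HasDerivAt x (v - (2 * a * s) • (p - c)) s := fun s => by
    have h1 : HasDerivAt (fun s : ℝ => p + s • v) v s := by
      simpa using ((hasDerivAt_id s).smul_const v).const_add p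
    have h2 : HasDerivAt (fun s : ℝ => a * s ^ 2) (2 * a * s) s :=
      ((hasDerivAt_pow 2 s).const_mul a).congr_deriv (by simp; ring)
    exact h1.sub (h2.smul_const (p - c))
  have hx0 : x 0 = p := by simp [hx]
  have hxt : Tendsto x (𝓝 0) (𝓝 p) := hx0 ▸ (hx' 0).continuousAt.tendsto
  have hnorm : ∀ s, ‖p - c‖ ≤ ‖x s - c‖ := fun s => by
    refine le_of_sq_le_sq ?_ (norm_nonneg _)
    have e : x s - c = (1 - a * s ^ 2) • (p - c) + s • v := by simp only [hx]; module
    have hav : ‖v‖ ^ 2 = 2 * a * ‖p - c‖ ^ 2 := by rw [ha]; field_simp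
    rw [e, norm_add_sq_real, inner_smul_left, inner_smul_right, hin, hfv, norm_smul, norm_smul,
      mul_pow, mul_pow, hav, Real.norm_eq_abs, Real.norm_eq_abs, sq_abs, sq_abs]
    simp only [mul_zero, add_zero]
    nlinarith [sq_nonneg (a * s ^ 2 * ‖p - c‖)]
  have hd1 : ∀ᶠ s in 𝓝 (0 : ℝ),
      HasDerivAt (fun s => f (x s)) (f' (x s) (v - (2 * a * s) • (p - c))) s := by
    filter_upwards [hxt.eventually hf] with s hs using hs.comp_hasDerivAt s (hx' s)
  have hd2 : HasDerivAt (fun s => f' (x s) (v - (2 * a * s) • (p - c)))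
      (f'' v v - 2 * a * f' p (p - c)) 0 := by
    have h1 : HasDerivAt (fun s => f' (x s)) (f'' (v - (2 * a * 0) • (p - c))) 0 :=
      HasFDerivAt.comp_hasDerivAt 0 (by rwa [hx0]) (hx' 0)
    have h2 : HasDerivAt (fun s : ℝ => v - (2 * a * s) • (p - c)) (-((2 * a) • (p - c))) 0 := by
      simpa using (((hasDerivAt_id (0 : ℝ)).const_mul (2 * a)).smul_const (p - c)).const_sub v
    refine (h1.clm_apply h2).congr_deriv ?_
    simp [hx0]
    ring
  have hmin : IsLocalMin (fun s => f (x s)) 0 := by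
    filter_upwards [hxt.eventually h] with s hs
    rw [hx0, hfp]
    by_contra! hc
    exact absurd (hs hc) (not_lt.2 (hnorm s))
  have hdd := hmin.deriv_deriv_nonneg hd1.self_of_nhds.continuousAt
  have heq : deriv (fun s => f (x s)) =ᶠ[𝓝 0] fun s => f' (x s) (v - (2 * a * s) • (p - c)) :=
    hd1.mono fun s hs => hs.deriv
  rw [heq.deriv_eq, hd2.deriv] at hdd
  have : 0 < 2 * a * f' p (p - c) := by positivity
  linarith

set_option maxSynthPendingDepth 3 in
open Filter Topology in
/-- Two-sided second-order estimates for a defining function `f` whose Hessian is positive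
definite on the tangent space at `p`. -/
theorem exists_ball_second_order_bounds {V : Type*} [NormedAddCommGroup V]
    [NormedSpace ℝ V] [FiniteDimensional ℝ V] {f : V → ℝ} {f' : V → V →L[ℝ] ℝ}
    {f'' : V → V →L[ℝ] V →L[ℝ] ℝ} {p : V}
    (hf : ∀ᶠ x in 𝓝 p, HasFDerivAt f (f' x) x) (hf' : ∀ᶠ x in 𝓝 p, HasFDerivAt f' (f'' x) x)
    (hf'' : ContinuousAt f'' p) (hfp : f p = 0)
    (hpos : ∀ v, v ≠ 0 → f' p v = 0 → 0 < f'' p v v) :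
    ∃ ε M δ : ℝ, 0 < ε ∧ 0 < M ∧ 0 < δ ∧ ∀ x ∈ ball p δ, ∀ y ∈ ball p δ,
      f y ≤ f x + f' x (y - x) + M / 2 * ‖y - x‖ ^ 2 ∧
      (f x = 0 → f y < 0 → f' x (y - x) + ε / 2 * ‖y - x‖ ^ 2 < 0) := by
  obtain ⟨K, ε, hK, hε, hB⟩ := exists_pos_le_add_mul_sq (f'' p) (f' p) hpos
  have hfc : ContinuousAt f p := hf.self_of_nhds.continuousAt
  have hf'c : ContinuousAt f' p := hf'.self_of_nhds.continuousAt
  set F'' : V → V →L[ℝ] V →L[ℝ] ℝ := fun x =>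
    (1 + K * f x) • f'' x + (K • f' x).smulRight (f' x) with hF''
  have hF''c : ContinuousAt F'' p := by
    have : ContinuousAt (fun x => (K • f' x).smulRight (f' x)) p :=
      (((ContinuousLinearMap.smulRightL ℝ V (V →L[ℝ] ℝ)).continuous.continuousAt.comp
        (hf'c.const_smul K))).clm_apply hf'c
    exact ((continuousAt_const.add (continuousAt_const.mul hfc)).smul hf'').add this
  have hF''p : ∀ v, ε * ‖v‖ ^ 2 ≤ F'' p v v := fun v => by
    refine (hB v).trans_eq ?_
    simp [hF'', hfp]
    ring
  have bound : ∀ (A : V →L[ℝ] V →L[ℝ] ℝ) (v : V), |A v v| ≤ ‖A‖ * ‖v‖ ^ 2 := fun A v => by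
    have := A.le_opNorm₂ v v
    rwa [mul_assoc, ← sq] at this
  have hnear : ∀ᶠ x in 𝓝 p, ‖F'' x - F'' p‖ < ε / 2 := by
    simpa [dist_eq_norm] using Metric.continuousAt_iff'.1 hF''c (ε / 2) (by positivity)
  have hbd : ∀ᶠ x in 𝓝 p, ‖f'' x‖ < ‖f'' p‖ + 1 := hf''.norm.eventually_lt_const (by simp)
  have hone : ∀ᶠ x in 𝓝 p, 0 < 1 + K / 2 * f x :=
    (continuousAt_const.add (continuousAt_const.mul hfc)).eventually_const_lt (by simp [hfp])
  obtain ⟨δ, hδ, hall⟩ := Metric.eventually_nhds_iff_ball.1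
    (hf.and (hf'.and (hnear.and (hbd.and hone))))
  refine ⟨ε / 2, ‖f'' p‖ + 1, δ, by positivity, by positivity, hδ, fun x hx y hy => ⟨?_, ?_⟩⟩
  · have := (convex_ball p δ).add_fderiv_add_le (f := fun x => -f x) (f' := fun x => -f' x)
      (f'' := fun x => -f'' x) (ε := -(‖f'' p‖ + 1)) (fun x hx => (hall x hx).1.neg)
      (fun x hx => (hall x hx).2.1.neg) (fun x hx v => ?_) hx hy
    · simp only [neg_apply] at this
      linarith
    · have h1 := bound (f'' x) v
      have h2 := (hall x hx).2.2.2.1.le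
      have h3 := mul_le_mul_of_nonneg_right h2 (sq_nonneg ‖v‖)
      simp only [neg_apply]
      linarith [le_abs_self (f'' x v v)]
  · intro hfx hfy
    have := (convex_ball p δ).add_fderiv_add_le (f := fun x => f x + K / 2 * f x ^ 2)
      (f' := fun x => (1 + K * f x) • f' x) (f'' := F'') (ε := ε / 2) (fun x hx => ?_)
      (fun x hx => ?_) (fun x hx v => ?_) hx hy
    · simp only [hfx, smul_apply, smul_eq_mul, mul_zero, add_zero, one_mul] at this
      have h2 := mul_neg_of_neg_of_pos hfy (hall y hy).2.2.2.2
      norm_num at this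
      rw [map_sub]
      linarith
    · have h1 := (hall x hx).1
      refine (h1.add ((h1.pow 2).const_mul (K / 2))).congr_fderiv ?_
      ext v
      simp
      ring
    · have h1 := (hall x hx).1
      have h2 := ((h1.const_mul K).const_add 1).smul (hall x hx).2.1
      exact h2
    · have h1 := bound (F'' x - F'' p) v
      have h2 := mul_le_mul_of_nonneg_right (hall x hx).2.2.1.le (sq_nonneg ‖v‖)
      have h3 := (abs_le.1 (h1.trans h2)).1
      have h4 := hF''p v
      simp only [sub_apply] at h3
      linarith

open Filter Topology in
/-- The differential of `f` is a positive multiple of the inner normal of a sphere touching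
`{f < 0}` from inside. -/
theorem exists_eq_inner_of_norm_lt_imp_neg {V : Type*} [NormedAddCommGroup V]
    [InnerProductSpace ℝ V] {f : V → ℝ} {f' : V →L[ℝ] ℝ} {b q : V} (hf : HasFDerivAt f f' b)
    (hfb : f b = 0) (hf' : f' ≠ 0) (hbq : b ≠ q)
    (h : ∀ᶠ y in 𝓝 b, ‖y - q‖ < ‖b - q‖ → f y < 0) :
    ∃ t : ℝ, 0 < t ∧ ∀ v, f' v = t * inner ℝ (b - q) v := by
  have hg : HasFDerivAt (fun y => ‖y - q‖ ^ 2 - ‖b - q‖ ^ 2)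
      (2 • (innerSL ℝ) (b - q) ∘SL ContinuousLinearMap.id ℝ V) b :=
    ((hasFDerivAt_id b).sub_const q).norm_sq.sub_const _
  have hne : 2 • (innerSL ℝ) (b - q) ∘SL ContinuousLinearMap.id ℝ V ≠ 0 := fun h0 => by
    have := DFunLike.congr_fun h0 (b - q)
    simp [← inner_sub_left, sub_eq_zero, hbq] at this
  obtain ⟨t, ht, hft⟩ := exists_fderiv_eq_smul_of_neg_imp_nonpos hg hf (by simp) hfb hne
    (h.mono fun y hy hgy => (hy (lt_of_pow_lt_pow_left₀ 2 (norm_nonneg _) (sub_neg.1 hgy))).le)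
  refine ⟨2 * t, ?_, fun v => ?_⟩
  · rcases ht.eq_or_lt with rfl | ht
    · exact absurd (ContinuousLinearMap.ext fun v => by simpa using hft v) hf'
    · positivity
  · rw [hft v]
    simp [← inner_sub_left]
    ring

/-- A continuous local defining function of an open set vanishes on the frontier. -/
theorem eq_zero_of_mem_frontier_of_inter_eq {V : Type*} [TopologicalSpace V] {Ω U : Set V}
    {f : V → ℝ} (hΩ : IsOpen Ω) (hU : IsOpen U) (hf : ContinuousOn f U)
    (hdef : Ω ∩ U = {x | f x < 0} ∩ U) {b : V} (hb : b ∈ frontier Ω) (hbU : b ∈ U) :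
    f b = 0 := by
  have hiff : ∀ x ∈ U, (x ∈ Ω ↔ f x < 0) := fun x hx => by
    simpa [hx] using Set.ext_iff.1 hdef x
  refine le_antisymm ?_ ?_
  · by_contra! hpos
    obtain ⟨x, ⟨hx0, hxU⟩, hxΩ⟩ := mem_closure_iff_nhds.1 (frontier_subset_closure hb) _
      (Filter.inter_mem ((hf.continuousAt (hU.mem_nhds hbU)).eventually_const_lt hpos)
        (hU.mem_nhds hbU))
    exact lt_asymm hx0 ((hiff x hxU).1 hxΩ)
  · rw [hΩ.frontier_eq] at hb
    exact not_lt.1 fun h => hb.2 ((hiff b hbU).2 h)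

/-- The unit vector in the direction opposite to the gradient represented by `l`. -/
noncomputable def descentDirection {V : Type*} [NormedAddCommGroup V] [InnerProductSpace ℝ V]
    [CompleteSpace V] (l : V →L[ℝ] ℝ) : V :=
  -(‖l‖⁻¹ • (InnerProductSpace.toDual ℝ V).symm l)

section descentDirection

variable {V : Type*} [NormedAddCommGroup V] [InnerProductSpace ℝ V] [CompleteSpace V]

theorem norm_descentDirection {l : V →L[ℝ] ℝ} (hl : l ≠ 0) : ‖descentDirection l‖ = 1 := by
  simp [descentDirection, norm_smul, hl]

theorem norm_mul_inner_descentDirection (l : V →L[ℝ] ℝ) (v : V) :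
    ‖l‖ * inner ℝ (descentDirection l) v = -l v := by
  rcases eq_or_ne l 0 with rfl | hl
  · simp
  have : ‖l‖ ≠ 0 := norm_ne_zero_iff.2 hl
  rw [descentDirection, inner_neg_left, real_inner_smul_left,
    InnerProductSpace.toDual_symm_apply]
  field_simp

theorem descentDirection_eq {l : V →L[ℝ] ℝ} {a : V} {t : ℝ} (ht : 0 < t)
    (h : ∀ v, inner ℝ a v = t * l v) : descentDirection l = -(‖a‖⁻¹ • a) := by
  have ha : a = t • (InnerProductSpace.toDual ℝ V).symm l := ext_inner_right ℝ fun v => by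
    rw [h, real_inner_smul_left, InnerProductSpace.toDual_symm_apply]
  rw [descentDirection, ha, norm_smul, LinearIsometryEquiv.norm_map, smul_smul, mul_inv,
    Real.norm_of_nonneg ht.le]
  congr 2
  field_simp

theorem continuousAt_descentDirection {l : V →L[ℝ] ℝ} (hl : l ≠ 0) :
    ContinuousAt descentDirection l :=
  ((continuousAt_id.norm.inv₀ (norm_ne_zero_iff.2 hl)).smul
    (InnerProductSpace.toDual ℝ V).symm.continuous.continuousAt).neg

end descentDirection

/-- Distance to the far endpoint of a segment of length `R` in the unit direction `u`. -/
theorem norm_sub_add_smul_sq {V : Type*} [NormedAddCommGroup V] [InnerProductSpace ℝ V]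
    {u : V} (hu : ‖u‖ = 1) (x b : V) (R : ℝ) :
    ‖x - (b + R • u)‖ ^ 2 = ‖x - b‖ ^ 2 - 2 * R * inner ℝ u (x - b) + R ^ 2 := by
  rw [← sub_sub, norm_sub_sq_real, real_inner_smul_right, norm_smul, hu, real_inner_comm,
    Real.norm_eq_abs, mul_one, sq_abs]
  ring

open Filter Topology in
/-- Sphere envelopes in a finite-dimensional real inner product space. -/
theorem exists_sphere_envelopes {V : Type*} [NormedAddCommGroup V] [InnerProductSpace ℝ V]
    [FiniteDimensional ℝ V] {Ω : Set V} (hopen : IsOpen Ω) {p : V} (hp : p ∈ frontier Ω)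
    {r₀ : ℝ} (hr₀ : 0 < r₀) {ρ : V → ℝ} (hρ : ContDiffOn ℝ 2 ρ (ball p r₀))
    (hgrad : ∀ x ∈ ball p r₀, fderiv ℝ ρ x ≠ 0)
    (hdef : Ω ∩ ball p r₀ = {x | ρ x < 0} ∩ ball p r₀)
    {c₀ : V} {R₀ : ℝ} (hR₀ : 0 < R₀) (hΩball : Ω ⊆ ball c₀ R₀) (hpc₀ : ‖p - c₀‖ = R₀) :
    ∃ r₂ R : ℝ, 0 < r₂ ∧ r₂ < r₀ ∧ 0 < R ∧
      ∀ q ∈ Ω ∩ ball p r₂, ∃ b c : V, b ∈ frontier Ω ∧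
        (∀ z ∈ frontier Ω, z ≠ b → ‖q - b‖ < ‖q - z‖) ∧ ‖c - b‖ = R ∧ Ω ⊆ ball c R := by
  set ρ' := fderiv ℝ ρ with hρ'def
  have hC1 : ContDiffOn ℝ 1 ρ' (ball p r₀) := hρ.fderiv_of_isOpen isOpen_ball (by norm_num)
  have hC2 : ContDiffOn ℝ 0 (fderiv ℝ ρ') (ball p r₀) :=
    hC1.fderiv_of_isOpen isOpen_ball (by norm_num)
  have nhds_of : ∀ x ∈ ball p r₀, ball p r₀ ∈ 𝓝 x := fun x hx => isOpen_ball.mem_nhds hx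
  have hp₀ : p ∈ ball p r₀ := mem_ball_self hr₀
  have hd1 : ∀ x ∈ ball p r₀, HasFDerivAt ρ (ρ' x) x := fun x hx =>
    ((hρ.differentiableOn (by norm_num)).differentiableAt (nhds_of x hx)).hasFDerivAt
  have hd2 : ∀ x ∈ ball p r₀, HasFDerivAt ρ' (fderiv ℝ ρ' x) x := fun x hx =>
    ((hC1.differentiableOn (by norm_num)).differentiableAt (nhds_of x hx)).hasFDerivAt
  have hmem : ∀ x ∈ ball p r₀, (x ∈ Ω ↔ ρ x < 0) := fun x hx => by
    simpa [hx] using Set.ext_iff.1 hdef x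
  have hzero : ∀ b ∈ frontier Ω, b ∈ ball p r₀ → ρ b = 0 := fun b hb hbU =>
    eq_zero_of_mem_frontier_of_inter_eq hopen isOpen_ball hρ.continuousOn hdef hb hbU
  have hpc : p ≠ c₀ := by
    rintro rfl
    simp at hpc₀
    exact hR₀.ne hpc₀
  have hsphere : ∀ᶠ y in 𝓝 p, ρ y < 0 → ‖y - c₀‖ < ‖p - c₀‖ := by
    filter_upwards [nhds_of p hp₀] with y hy hρy
    rw [hpc₀, ← mem_ball_iff_norm]
    exact hΩball ((hmem y hy).2 hρy)
  have hpp := hzero p hp hp₀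
  have hd1e := eventually_of_mem (nhds_of p hp₀) hd1
  obtain ⟨ε, M, δ₀, hε, hM, hδ₀, hbounds⟩ := exists_ball_second_order_bounds
    hd1e (eventually_of_mem (nhds_of p hp₀) hd2)
    (hC2.continuousOn.continuousAt (nhds_of p hp₀)) hpp
    (fun v hv hv' => fderiv_fderiv_pos_of_neg_imp_norm_lt hd1e (hd2 p hp₀) hpp (hgrad p hp₀)
      hpc hsphere hv hv')
  obtain ⟨t₀, ht₀, hnormal⟩ :=
    exists_inner_eq_of_neg_imp_norm_lt (hd1 p hp₀) hpp (hgrad p hp₀) hpc hsphere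
  set ν : V → V := fun x => descentDirection (ρ' x) with hν
  have hνp : c₀ = p + R₀ • ν p := by
    simp only [hν]
    rw [descentDirection_eq ht₀ hnormal, hpc₀, smul_neg, smul_smul, mul_inv_cancel₀ hR₀.ne']
    module
  have hν1 : ∀ x ∈ ball p r₀, ‖ν x‖ = 1 := fun x hx => norm_descentDirection (hgrad x hx)
  set δ := min δ₀ r₀ with hδdef
  have hδ : 0 < δ := lt_min hδ₀ hr₀
  have hg : 0 < ‖ρ' p‖ := norm_pos_iff.2 (hgrad p hp₀)
  set R := max (2 * R₀) ((‖ρ' p‖ + 1) / ε) with hRdef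
  have hRR₀ : 2 * R₀ ≤ R := le_max_left _ _
  have hRε : ‖ρ' p‖ + 1 ≤ R * ε := (div_le_iff₀ hε).1 (le_max_right _ _)
  have hR : 0 < R := by linarith
  have hsqrt : √(R ^ 2 - δ ^ 2) < R := by
    rw [Real.sqrt_lt' hR]
    nlinarith
  have hρ'c : ContinuousAt ρ' p := (hd2 p hp₀).continuousAt
  have hcenter : ContinuousAt (fun x => x + R • ν x) p :=
    continuousAt_id.add (((continuousAt_descentDirection (hgrad p hp₀)).comp hρ'c).const_smul R)
  obtain ⟨δ₁, hδ₁, hnear⟩ := Metric.eventually_nhds_iff_ball.1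
    ((Metric.continuousAt_iff'.1 hcenter _ (sub_pos.2 hsqrt)).and
      ((hρ'c.norm.eventually_const_lt (half_lt_self hg)).and
        (hρ'c.norm.eventually_lt_const (lt_add_one _))))
  set r₂ := min (min (δ / 2) (δ₁ / 2)) (‖ρ' p‖ / 2 / M) with hr₂
  have hr₂δ : r₂ ≤ δ / 2 := (min_le_left _ _).trans (min_le_left _ _)
  have hr₂δ₁ : r₂ ≤ δ₁ / 2 := (min_le_left _ _).trans (min_le_right _ _)
  have hr₂M : r₂ * M ≤ ‖ρ' p‖ / 2 := (le_div_iff₀ hM).1 (min_le_right _ _)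
  have hδr : δ ≤ r₀ := min_le_right _ _
  have hδδ₀ : δ ≤ δ₀ := min_le_left _ _
  refine ⟨r₂, R, by positivity, by linarith, hR, ?_⟩
  rintro q ⟨hqΩ, hqp⟩
  have hcompl : ∀ z ∈ frontier Ω, z ∈ Ωᶜ := fun z hz => by
    rw [hopen.frontier_eq] at hz
    exact hz.2
  obtain ⟨b, hb, hqb⟩ := exists_mem_frontier_infDist_compl_eq_dist hqΩ
    (fun h => hcompl p hp (h ▸ mem_univ p))
  have hnearest : ∀ z ∈ frontier Ω, dist q b ≤ dist q z := fun z hz =>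
    hqb ▸ infDist_le_dist_of_mem (hcompl z hz)
  have hinner : ball q (dist q b) ⊆ Ω := hqb ▸ ball_infDist_compl_subset
  have hqp' : dist q p < r₂ := hqp
  have hclose : ∀ z, dist q z ≤ dist q b → dist z p < 2 * r₂ := fun z hz => by
    linarith [dist_triangle_left z p q, hnearest p hp]
  have hδ_of : ∀ z, dist q z ≤ dist q b → z ∈ ball p δ := fun z hz =>
    mem_ball.2 ((hclose z hz).trans_le (by linarith))
  have hbδ := hδ_of b le_rfl
  have hbr := ball_subset_ball hδr hbδ
  obtain ⟨hcb, hlow, hup⟩ := hnear b (mem_ball.2 ((hclose b le_rfl).trans_le (by linarith)))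
  have hbq : b ≠ q := fun h => hcompl b hb (h ▸ hqΩ)
  have hρb := hzero b hb hbr
  obtain ⟨t, ht, hρ'b⟩ := exists_eq_inner_of_norm_lt_imp_neg (hd1 b hbr) hρb (hgrad b hbr) hbq (by
    filter_upwards [nhds_of b hbr] with y hy hyq
    refine (hmem y hy).1 (hinner ?_)
    rwa [mem_ball, dist_eq_norm, dist_comm, dist_eq_norm])
  refine ⟨b, b + R • ν b, hb, fun z hz hzb => ?_, ?_, fun x hx => ?_⟩
  · by_contra! hle
    rw [← dist_eq_norm, ← dist_eq_norm] at hle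
    have hzδ := hδ_of z hle
    have h1 := (hbounds b (ball_subset_ball hδδ₀ hbδ) z (ball_subset_ball hδδ₀ hzδ)).1
    rw [hρb, hzero z hz (ball_subset_ball hδr hzδ), hρ'b, zero_add] at h1
    have htM : M < t := by
      have h2 : ‖ρ' b‖ ≤ t * ‖b - q‖ := (ρ' b).opNorm_le_bound (by positivity) fun v => by
        rw [hρ'b, norm_mul, Real.norm_of_nonneg ht.le, mul_assoc]
        gcongr
        exact norm_inner_le_norm _ _
      have h3 : ‖b - q‖ < r₂ := by
        rw [← dist_eq_norm, dist_comm]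
        exact (hnearest p hp).trans_lt hqp'
      have h4 : 0 < ‖b - q‖ := norm_pos_iff.2 (sub_ne_zero.2 hbq)
      nlinarith
    have h5 : ‖z - q‖ ^ 2 = ‖z - b‖ ^ 2 + 2 * inner ℝ (b - q) (z - b) + ‖b - q‖ ^ 2 := by
      rw [← sub_add_sub_cancel z b q, norm_add_sq_real, real_inner_comm]
    have h6 : ‖z - q‖ ^ 2 ≤ ‖b - q‖ ^ 2 := by
      rw [← dist_eq_norm, ← dist_eq_norm, dist_comm z, dist_comm b]
      gcongr
    have h7 : 0 < ‖z - b‖ := norm_pos_iff.2 (sub_ne_zero.2 hzb)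
    have h8 : t * (2 * inner ℝ (b - q) (z - b)) ≤ t * -‖z - b‖ ^ 2 := by
      gcongr
      linarith
    have h9 : 0 < (t - M) * ‖z - b‖ ^ 2 := mul_pos (sub_pos.2 htM) (by positivity)
    linarith
  · simp [norm_smul, hν1 b hbr, hR.le]
  · rw [mem_ball_iff_norm]
    by_cases hxδ : x ∈ ball p δ
    · have h1 := (hbounds b (ball_subset_ball hδδ₀ hbδ) x (ball_subset_ball hδδ₀ hxδ)).2 hρb
        ((hmem x (ball_subset_ball hδr hxδ)).1 hx)
      have h2 : ‖ρ' b‖ * inner ℝ (ν b) (x - b) = -ρ' b (x - b) :=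
        norm_mul_inner_descentDirection _ _
      refine lt_of_pow_lt_pow_left₀ 2 hR.le ?_
      rw [norm_sub_add_smul_sq (hν1 b hbr)]
      have h3 : 0 < ‖ρ' b‖ * inner ℝ (ν b) (x - b) := by
        have : 0 ≤ ε / 2 * ‖x - b‖ ^ 2 := by positivity
        linarith
      have h4 : 0 < inner ℝ (ν b) (x - b) := pos_of_mul_pos_right h3 (norm_nonneg _)
      have h5 : ‖ρ' b‖ * inner ℝ (ν b) (x - b) ≤ R * ε * inner ℝ (ν b) (x - b) := by
        gcongr
        linarith
      have h6 : ε * ‖x - b‖ ^ 2 < ε * (2 * R * inner ℝ (ν b) (x - b)) := by linarith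
      linarith [lt_of_mul_lt_mul_left h6 hε.le]
    · have h1 : ‖x - c₀‖ ^ 2 < R₀ ^ 2 := by
        have := mem_ball_iff_norm.1 (hΩball hx)
        gcongr
      rw [hνp, norm_sub_add_smul_sq (hν1 p hp₀)] at h1
      have h2 : δ ^ 2 ≤ ‖x - p‖ ^ 2 := by
        rw [mem_ball_iff_norm, not_lt] at hxδ
        gcongr
      have h3 : 0 < inner ℝ (ν p) (x - p) := by
        have h0 : 0 < 2 * R₀ * inner ℝ (ν p) (x - p) := by nlinarith
        exact pos_of_mul_pos_right h0 (by positivity)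
      have h4 : 2 * R₀ * inner ℝ (ν p) (x - p) ≤ R * inner ℝ (ν p) (x - p) := by gcongr
      have h5 : ‖x - (p + R • ν p)‖ ≤ √(R ^ 2 - δ ^ 2) := by
        refine Real.le_sqrt_of_sq_le ?_
        rw [norm_sub_add_smul_sq (hν1 p hp₀)]
        linarith
      rw [dist_eq_norm, norm_sub_rev] at hcb
      linarith [norm_sub_le_norm_sub_add_norm_sub x (p + R • ν p) (b + R • ν b)]

/-- (Sphere envelopes.) If `Ω ⊆ ℂⁿ` is a bounded domain and
`p ∈ ∂Ω` is a spherically-extreme boundary point with `∂Ω` of class `C²` on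
`B(p, r₀)`, then there are `0 < r₂ < r₀` and `R > 0` such that every
`q ∈ Ω ∩ B(p, r₂)` admits `b(q) ∈ ∂Ω` and `c(q) ∈ ℂⁿ` with
(i) `b(q)` the unique closest boundary point to `q`, and
(ii) `‖c(q) - b(q)‖ = R` and `Ω ⊆ B(c(q), R)`. -/
theorem sphere_envelopes (n : ℕ)
    (Ω : Set (EuclideanSpace ℂ (Fin n)))
    (hopen : IsOpen Ω) (hconn : IsConnected Ω) (hbdd : Bornology.IsBounded Ω)
    (p : EuclideanSpace ℂ (Fin n)) (hp : p ∈ frontier Ω)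
    (r₀ : ℝ) (hr₀ : 0 < r₀)
    (ρ : EuclideanSpace ℂ (Fin n) → ℝ)
    (hρ : ContDiffOn ℝ 2 ρ (ball p r₀))
    (hgrad : ∀ x ∈ ball p r₀, fderiv ℝ ρ x ≠ 0)
    (hdef : Ω ∩ ball p r₀ = {x | ρ x < 0} ∩ ball p r₀)
    (c₀ : EuclideanSpace ℂ (Fin n)) (R₀ : ℝ) (hR₀ : 0 < R₀)
    (hΩball : Ω ⊆ ball c₀ R₀) (hpc₀ : ‖p - c₀‖ = R₀) :
    ∃ r₂ R : ℝ, 0 < r₂ ∧ r₂ < r₀ ∧ 0 < R ∧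
      ∀ q ∈ Ω ∩ ball p r₂, ∃ b c : EuclideanSpace ℂ (Fin n),
        b ∈ frontier Ω ∧
        (∀ z ∈ frontier Ω, z ≠ b → ‖q - b‖ < ‖q - z‖) ∧
        ‖c - b‖ = R ∧ Ω ⊆ ball c R := by
  exact exists_sphere_envelopes hopen hp hr₀ hρ hgrad hdef hR₀ hΩball hpc₀
end
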